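/- arXiv:2601.02540 — 11 statements merged into one kernel-verified Lean document; each statement's English description precedes it below -/
import Mathlib

section
/- For the periodic split-form semidiscretization of the 2D hyperbolic Serre–Green–Naghdi equations: if D_x and D_y are periodic first-derivative SBP operators with common diagonal positive-definite mass matrix M, and the differentiable time-dependent grid functions h, u, v, w, η (with h(t) componentwise positive) satisfy the semidiscretization for all t, then the total water mass 𝟏ᵀ M h(t) is constant in time, i.e., its time derivative vanishes at every time t. -/
open Matrix

theorem one_dotProduct_mulVec_mul_of_isDiag {ι R : Type*} [Fintype ι] [DecidableEq ι]
    [CommRing R] {M : Matrix ι ι R} (hM : M.IsDiag) (a c : ι → R) :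
    (1 : ι → R) ⬝ᵥ (M *ᵥ (a * c)) = a ⬝ᵥ (M *ᵥ c) := by
  rw [← hM.diagonal_diag]
  simp only [dotProduct, mulVec_diagonal, Pi.one_apply, Pi.mul_apply]
  exact Finset.sum_congr rfl fun i _ => by ring

/-- The discrete product rule of a periodic SBP operator integrates to zero. -/
theorem one_dotProduct_mulVec_productRule_eq_zero {ι R : Type*} [Fintype ι] [DecidableEq ι]
    [CommRing R] {M D : Matrix ι ι R} (hM : M.IsDiag) (hD : M * D + Dᵀ * M = 0) (a c : ι → R) :
    (1 : ι → R) ⬝ᵥ (M *ᵥ (a * (D *ᵥ c) + c * (D *ᵥ a))) = 0 := by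
  have hsbp : a ⬝ᵥ ((M * D + Dᵀ * M) *ᵥ c) = 0 := by simp [hD]
  rw [add_mulVec, dotProduct_add, ← mulVec_mulVec, ← mulVec_mulVec, dotProduct_mulVec a Dᵀ,
    vecMul_transpose] at hsbp
  rw [mulVec_add, dotProduct_add, mul_comm c, one_dotProduct_mulVec_mul_of_isDiag hM,
    one_dotProduct_mulVec_mul_of_isDiag hM, hsbp]

/-- A linear functional `x ↦ y ⬝ᵥ (M *ᵥ x)` commutes with componentwise differentiation. -/
theorem HasDerivAt.dotProduct_mulVec {ι : Type*} [Fintype ι] (y : ι → ℝ) (M : Matrix ι ι ℝ)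
    {f : ℝ → ι → ℝ} {f' : ι → ℝ} {t : ℝ} (hf : ∀ i, HasDerivAt (fun s => f s i) (f' i) t) :
    HasDerivAt (fun s => y ⬝ᵥ (M *ᵥ f s)) (y ⬝ᵥ (M *ᵥ f')) t := by
  simp only [dotProduct, mulVec]
  exact HasDerivAt.fun_sum fun i _ =>
    (HasDerivAt.fun_sum fun j _ => (hf j).const_mul (M i j)).const_mul (y i)

theorem periodic_mass_conservation
    {ι : Type*} [Fintype ι] [DecidableEq ι] [Nonempty ι]
    (M Dx Dy : Matrix ι ι ℝ)
    (hMdiag : M.IsDiag) (hMpd : M.PosDef)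
    (hSBPx : M * Dx + Dxᵀ * M = 0) (hSBPy : M * Dy + Dyᵀ * M = 0)
    (g lam : ℝ) (hg : 0 < g) (hlam : 0 ≤ lam) (b : ι → ℝ)
    (h u v w η h' u' v' w' η' : ℝ → ι → ℝ)
    (hdh : ∀ (t : ℝ) (i : ι), HasDerivAt (fun s => h s i) (h' t i) t)
    (hdu : ∀ (t : ℝ) (i : ι), HasDerivAt (fun s => u s i) (u' t i) t)
    (hdv : ∀ (t : ℝ) (i : ι), HasDerivAt (fun s => v s i) (v' t i) t)
    (hdw : ∀ (t : ℝ) (i : ι), HasDerivAt (fun s => w s i) (w' t i) t)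
    (hdη : ∀ (t : ℝ) (i : ι), HasDerivAt (fun s => η s i) (η' t i) t)
    (hpos : ∀ (t : ℝ) (i : ι), 0 < h t i)
    (heqh : ∀ t : ℝ, h' t = -(u t * (Dx *ᵥ h t) + h t * (Dx *ᵥ u t) + v t * (Dy *ᵥ h t) + h t * (Dy *ᵥ v t)))
    (hequ : ∀ t : ℝ, h t * u' t = -(g • (Dx *ᵥ (h t * (h t + b))) - g • ((h t + b) * (Dx *ᵥ h t)) + (1/2 : ℝ) • (h t * (Dx *ᵥ (u t^2))) - (1/2 : ℝ) • (u t^2 * (Dx *ᵥ h t)) + (1/2 : ℝ) • (u t * (Dx *ᵥ (h t * u t))) - (1/2 : ℝ) • (h t * u t * (Dx *ᵥ u t)) + (1/2 : ℝ) • (Dy *ᵥ (h t * u t * v t)) - (1/2 : ℝ) • (u t * v t * (Dy *ᵥ h t)) + (1/2 : ℝ) • (h t * v t * (Dy *ᵥ u t)) - (1/2 : ℝ) • (h t * u t * (Dy *ᵥ v t)) + (lam/6) • ((η t^2 / h t^2) * (Dx *ᵥ h t)) + (lam/3) • (Dx *ᵥ η t) - (lam/3) • ((η t / h t) * (Dx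 *ᵥ η t)) - (lam/6) • (Dx *ᵥ (η t^2 / h t)) + (lam/2) • ((1 - η t / h t) * (Dx *ᵥ b))))
    (heqv : ∀ t : ℝ, h t * v' t = -(g • (Dy *ᵥ (h t * (h t + b))) - g • ((h t + b) * (Dy *ᵥ h t)) + (1/2 : ℝ) • (h t * (Dy *ᵥ (v t^2))) - (1/2 : ℝ) • (v t^2 * (Dy *ᵥ h t)) + (1/2 : ℝ) • (v t * (Dy *ᵥ (h t * v t))) - (1/2 : ℝ) • (h t * v t * (Dy *ᵥ v t)) + (1/2 : ℝ) • (Dx *ᵥ (h t * u t * v t)) - (1/2 : ℝ) • (u t * v t * (Dx *ᵥ h t)) + (1/2 : ℝ) • (h t * u t * (Dx *ᵥ v t)) - (1/2 : ℝ) • (h t * v t * (Dx *ᵥ u t)) + (lam/6) • ((η t^2 / h t^2) * (Dy *ᵥ h t)) + (lam/3) • (Dy *ᵥ η t) - (lam/3) • ((η t / h t) * (Dy *ᵥ η t)) - (lam/6) • (Dy *ᵥ (η t^2 / h t)) + (lam/2) • ((1 - η t / h t) * (Dy *ᵥ b))))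
    (heqw : ∀ t : ℝ, h t * w' t = -((1/2 : ℝ) • (Dx *ᵥ (h t * u t * w t)) + (1/2 : ℝ) • (h t * u t * (Dx *ᵥ w t)) - (1/2 : ℝ) • (u t * w t * (Dx *ᵥ h t)) - (1/2 : ℝ) • (h t * w t * (Dx *ᵥ u t)) + (1/2 : ℝ) • (Dy *ᵥ (h t * v t * w t)) + (1/2 : ℝ) • (h t * v t * (Dy *ᵥ w t)) - (1/2 : ℝ) • (v t * w t * (Dy *ᵥ h t)) - (1/2 : ℝ) • (h t * w t * (Dy *ᵥ v t))) + lam • ((1 : ι → ℝ) - η t / h t))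
    (heqη : ∀ t : ℝ, η' t = -(u t * (Dx *ᵥ η t) + v t * (Dy *ᵥ η t) + (3/2 : ℝ) • (u t * (Dx *ᵥ b)) + (3/2 : ℝ) • (v t * (Dy *ᵥ b))) + w t) :
    ∀ t : ℝ, HasDerivAt (fun s => (1 : ι → ℝ) ⬝ᵥ (M *ᵥ h s)) 0 t := by
  intro t
  have hmass := HasDerivAt.dotProduct_mulVec 1 M (hdh t)
  have hzero : (1 : ι → ℝ) ⬝ᵥ (M *ᵥ h' t) = 0 := by
    rw [heqh t, add_assoc, mulVec_neg, mulVec_add, dotProduct_neg, dotProduct_add,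
      one_dotProduct_mulVec_productRule_eq_zero hMdiag hSBPx,
      one_dotProduct_mulVec_productRule_eq_zero hMdiag hSBPy, add_zero, neg_zero]
  rwa [hzero] at hmass
end

section
/- For the periodic split-form semidiscretization of the 2D hyperbolic Serre–Green–Naghdi equations: if D_x and D_y are periodic first-derivative SBP operators with common diagonal positive-definite mass matrix M, and the differentiable time-dependent grid functions h, u, v, w, η (with h(t) componentwise positive) satisfy the semidiscretization for all t, then the total discrete energy 𝟏ᵀ M E(t), with E = h ∘ ((u² + v²)/2 + w²/6 + (g/2)(h + 2b) + (λ/6)(η/h − 𝟏)²), is constant in time, i.e., its time derivative vanishes at every time t. -/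
open Matrix

/-- Summation by parts for a periodic SBP operator with diagonal mass matrix, in nodal form. -/
lemma sum_diag_mul_sbp_eq_zero {ι : Type*} [Fintype ι] [DecidableEq ι] {M D : Matrix ι ι ℝ}
    (hM : M.IsDiag) (hD : M * D + Dᵀ * M = 0) (a c : ι → ℝ) :
    ∑ i, M i i * (a i * (D *ᵥ c) i + c i * (D *ᵥ a) i) = 0 := by
  obtain ⟨d, rfl⟩ : ∃ d, M = diagonal d := ⟨M.diag, hM.diagonal_diag.symm⟩
  have entry (i j : ι) : d i * D i j + D j i * d j = 0 := by
    simpa using congrFun (congrFun hD i) j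
  have swap : ∑ i, d i * (c i * (D *ᵥ a) i) = ∑ i, ∑ j, d j * c j * D j i * a i := by
    rw [Finset.sum_comm]
    simp only [mulVec, dotProduct, Finset.mul_sum, mul_assoc]
  simp only [diagonal_apply_eq, mul_add, Finset.sum_add_distrib]
  rw [swap]
  simp only [mulVec, dotProduct, Finset.mul_sum, ← Finset.sum_add_distrib]
  refine Finset.sum_eq_zero fun i _ => Finset.sum_eq_zero fun j _ => ?_
  linear_combination a i * c j * entry i j

/-- The nodal energy of the hyperbolic Serre–Green–Naghdi equations, differentiated in time. -/
lemma hasDerivAt_nodal_energy {h u v w η : ℝ → ℝ} {h' u' v' w' η' t : ℝ} (g lam b : ℝ)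
    (hh : HasDerivAt h h' t) (hu : HasDerivAt u u' t) (hv : HasDerivAt v v' t)
    (hw : HasDerivAt w w' t) (hη : HasDerivAt η η' t) (h0 : h t ≠ 0) :
    HasDerivAt (fun s => h s * ((u s ^ 2 + v s ^ 2) / 2 + w s ^ 2 / 6 + g / 2 * (h s + 2 * b)
        + lam / 6 * (η s / h s - 1) ^ 2))
      (h' * ((u t ^ 2 + v t ^ 2) / 2 + w t ^ 2 / 6 + g * (h t + b)
          + lam / 6 * (1 - (η t / h t) ^ 2))
        + u t * (h t * u') + v t * (h t * v') + w t / 3 * (h t * w')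
        + lam / 3 * (η t / h t - 1) * η') t := by
  have key := hh.mul ((((((hu.pow 2).add (hv.pow 2)).div_const 2).add
    ((hw.pow 2).div_const 6)).add ((hh.add_const (2 * b)).const_mul (g / 2))).add
    ((((hη.div hh h0).sub_const 1).pow 2).const_mul (lam / 6)))
  refine key.congr_deriv ?_
  simp only [Pi.add_apply, Pi.pow_apply, Pi.div_apply, Nat.cast_ofNat,
    Nat.add_one_sub_one, pow_one]
  field_simp
  ring

theorem periodic_energy_conservation
    {ι : Type*} [Fintype ι] [DecidableEq ι] [Nonempty ι]
    (M Dx Dy : Matrix ι ι ℝ)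
    (hMdiag : M.IsDiag) (hMpd : M.PosDef)
    (hSBPx : M * Dx + Dxᵀ * M = 0) (hSBPy : M * Dy + Dyᵀ * M = 0)
    (g lam : ℝ) (hg : 0 < g) (hlam : 0 ≤ lam) (b : ι → ℝ)
    (h u v w η h' u' v' w' η' : ℝ → ι → ℝ)
    (hdh : ∀ (t : ℝ) (i : ι), HasDerivAt (fun s => h s i) (h' t i) t)
    (hdu : ∀ (t : ℝ) (i : ι), HasDerivAt (fun s => u s i) (u' t i) t)
    (hdv : ∀ (t : ℝ) (i : ι), HasDerivAt (fun s => v s i) (v' t i) t)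
    (hdw : ∀ (t : ℝ) (i : ι), HasDerivAt (fun s => w s i) (w' t i) t)
    (hdη : ∀ (t : ℝ) (i : ι), HasDerivAt (fun s => η s i) (η' t i) t)
    (hpos : ∀ (t : ℝ) (i : ι), 0 < h t i)
    (heqh : ∀ t : ℝ, h' t = -(u t * (Dx *ᵥ h t) + h t * (Dx *ᵥ u t) + v t * (Dy *ᵥ h t) + h t * (Dy *ᵥ v t)))
    (hequ : ∀ t : ℝ, h t * u' t = -(g • (Dx *ᵥ (h t * (h t + b))) - g • ((h t + b) * (Dx *ᵥ h t)) + (1/2 : ℝ) • (h t * (Dx *ᵥ (u t^2))) - (1/2 : ℝ) • (u t^2 * (Dx *ᵥ h t)) + (1/2 : ℝ) • (u t * (Dx *ᵥ (h t * u t))) - (1/2 : ℝ) • (h t * u t * (Dx *ᵥ u t)) + (1/2 : ℝ) • (Dy *ᵥ (h t * u t * v t)) - (1/2 : ℝ) • (u t * v t * (Dy *ᵥ h t)) + (1/2 : ℝ) • (h t * v t * (Dy *ᵥ u t)) - (1/2 : ℝ) • (h t * u t * (Dy *ᵥ v t)) + (lam/6) • ((η t^2 / h t^2) * (Dx *ᵥ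 h t)) + (lam/3) • (Dx *ᵥ η t) - (lam/3) • ((η t / h t) * (Dx *ᵥ η t)) - (lam/6) • (Dx *ᵥ (η t^2 / h t)) + (lam/2) • ((1 - η t / h t) * (Dx *ᵥ b))))
    (heqv : ∀ t : ℝ, h t * v' t = -(g • (Dy *ᵥ (h t * (h t + b))) - g • ((h t + b) * (Dy *ᵥ h t)) + (1/2 : ℝ) • (h t * (Dy *ᵥ (v t^2))) - (1/2 : ℝ) • (v t^2 * (Dy *ᵥ h t)) + (1/2 : ℝ) • (v t * (Dy *ᵥ (h t * v t))) - (1/2 : ℝ) • (h t * v t * (Dy *ᵥ v t)) + (1/2 : ℝ) • (Dx *ᵥ (h t * u t * v t)) - (1/2 : ℝ) • (u t * v t * (Dx *ᵥ h t)) + (1/2 : ℝ) • (h t * u t * (Dx *ᵥ v t)) - (1/2 : ℝ) • (h t * v t * (Dx *ᵥ u t)) + (lam/6) • ((η t^2 / h t^2) * (Dy *ᵥ h t)) + (lam/3) • (Dy *ᵥ η t) - (lam/3) • ((η t / h t) * (Dy *ᵥ η t)) - (lam/6) • (Dy *ᵥ (η t^2 / h t)) + (lam/2) • ((1 - η t /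 h t) * (Dy *ᵥ b))))
    (heqw : ∀ t : ℝ, h t * w' t = -((1/2 : ℝ) • (Dx *ᵥ (h t * u t * w t)) + (1/2 : ℝ) • (h t * u t * (Dx *ᵥ w t)) - (1/2 : ℝ) • (u t * w t * (Dx *ᵥ h t)) - (1/2 : ℝ) • (h t * w t * (Dx *ᵥ u t)) + (1/2 : ℝ) • (Dy *ᵥ (h t * v t * w t)) + (1/2 : ℝ) • (h t * v t * (Dy *ᵥ w t)) - (1/2 : ℝ) • (v t * w t * (Dy *ᵥ h t)) - (1/2 : ℝ) • (h t * w t * (Dy *ᵥ v t))) + lam • ((1 : ι → ℝ) - η t / h t))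
    (heqη : ∀ t : ℝ, η' t = -(u t * (Dx *ᵥ η t) + v t * (Dy *ᵥ η t) + (3/2 : ℝ) • (u t * (Dx *ᵥ b)) + (3/2 : ℝ) • (v t * (Dy *ᵥ b))) + w t) :
    ∀ t : ℝ, HasDerivAt (fun s => (1 : ι → ℝ) ⬝ᵥ (M *ᵥ (h s * ((u s^2 + v s^2)/2 + w s^2/6 + (g/2) • (h s + (2:ℝ) • b) + (lam/6) • (η s / h s - 1)^2)))) 0 t := by
  intro t
  have hE : (fun s => (1 : ι → ℝ) ⬝ᵥ (M *ᵥ (h s * ((u s^2 + v s^2)/2 + w s^2/6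
      + (g/2) • (h s + (2:ℝ) • b) + (lam/6) • (η s / h s - 1)^2)))) =
      fun s => ∑ i, M i i * (h s i * ((u s i ^ 2 + v s i ^ 2) / 2 + w s i ^ 2 / 6
        + g / 2 * (h s i + 2 * b i) + lam / 6 * (η s i / h s i - 1) ^ 2)) := by
    funext s
    conv_lhs => rw [← hMdiag.diagonal_diag]
    simp only [dotProduct, mulVec_diagonal, diag_apply, one_mul, Pi.mul_apply,
      Pi.add_apply, Pi.sub_apply, Pi.div_apply, Pi.pow_apply, Pi.smul_apply, Pi.ofNat_apply,
      smul_eq_mul]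
  rw [hE]
  refine (HasDerivAt.fun_sum fun i _ => (hasDerivAt_nodal_energy g lam (b i) (hdh t i) (hdu t i)
    (hdv t i) (hdw t i) (hdη t i) (hpos t i).ne').const_mul (M i i)).congr_deriv ?_
  have sx := sum_diag_mul_sbp_eq_zero hMdiag hSBPx
  have sy := sum_diag_mul_sbp_eq_zero hMdiag hSBPy
  have total :
      g * ∑ i, M i i *
          (u t i * (Dx *ᵥ (h t * (h t + b))) i
            + (h t * (h t + b)) i * (Dx *ᵥ u t) i)
      + (1 / 2) * ∑ i, M i i *
          ((h t * u t) i * (Dx *ᵥ (u t ^ 2)) i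
            + (u t ^ 2) i * (Dx *ᵥ (h t * u t)) i)
      + (1 / 2) * ∑ i, M i i *
          (v t i * (Dx *ᵥ (h t * u t * v t)) i
            + (h t * u t * v t) i * (Dx *ᵥ v t) i)
      + (1 / 6) * ∑ i, M i i *
          (w t i * (Dx *ᵥ (h t * u t * w t)) i
            + (h t * u t * w t) i * (Dx *ᵥ w t) i)
      + -(lam / 6) * ∑ i, M i i *
          (u t i * (Dx *ᵥ (η t ^ 2 / h t)) i
            + (η t ^ 2 / h t) i * (Dx *ᵥ u t) i)
      + (lam / 6) * ∑ i, M i i *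
          (u t i * (Dx *ᵥ h t) i
            + h t i * (Dx *ᵥ u t) i)
      + g * ∑ i, M i i *
          (v t i * (Dy *ᵥ (h t * (h t + b))) i
            + (h t * (h t + b)) i * (Dy *ᵥ v t) i)
      + (1 / 2) * ∑ i, M i i *
          ((h t * v t) i * (Dy *ᵥ (v t ^ 2)) i
            + (v t ^ 2) i * (Dy *ᵥ (h t * v t)) i)
      + (1 / 2) * ∑ i, M i i *
          (u t i * (Dy *ᵥ (h t * u t * v t)) i
            + (h t * u t * v t) i * (Dy *ᵥ u t) i)
      + (1 / 6) * ∑ i, M i i *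
          (w t i * (Dy *ᵥ (h t * v t * w t)) i
            + (h t * v t * w t) i * (Dy *ᵥ w t) i)
      + -(lam / 6) * ∑ i, M i i *
          (v t i * (Dy *ᵥ (η t ^ 2 / h t)) i
            + (η t ^ 2 / h t) i * (Dy *ᵥ v t) i)
      + (lam / 6) * ∑ i, M i i *
          (v t i * (Dy *ᵥ h t) i
            + h t i * (Dy *ᵥ v t) i) = 0 := by
    simp only [sx, sy, mul_zero, add_zero]
  rw [← neg_eq_zero, ← total]
  simp only [Finset.mul_sum, ← Finset.sum_add_distrib, ← Finset.sum_neg_distrib]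
  refine Finset.sum_congr rfl fun i _ => ?_
  have eh := congrFun (heqh t) i
  have eu := congrFun (hequ t) i
  have ev := congrFun (heqv t) i
  have ew := congrFun (heqw t) i
  have eη := congrFun (heqη t) i
  have hi : h t i ≠ 0 := (hpos t i).ne'
  obtain ⟨q, hq⟩ : ∃ q, η t i = q * h t i := ⟨η t i / h t i, by field_simp⟩
  have hq1 : η t i / h t i = q := by rw [hq]; field_simp
  have hq2 : η t i ^ 2 / h t i ^ 2 = q ^ 2 := by rw [hq]; field_simp
  have hq3 : η t i ^ 2 / h t i = q ^ 2 * h t i := by rw [hq]; field_simp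
  simp only [Pi.add_apply, Pi.sub_apply, Pi.neg_apply, Pi.mul_apply, Pi.div_apply, Pi.pow_apply,
    Pi.smul_apply, Pi.one_apply, smul_eq_mul, hq1, hq2, hq3] at eh eu ev ew eη ⊢
  rw [eh, eu, ev, ew, eη]
  ring
end

section
/- For the split-form semidiscretization of the 2D hyperbolic Serre–Green–Naghdi equations with weakly enforced reflecting boundary conditions: if D_x and D_y are non-periodic first-derivative SBP operators with common diagonal positive-definite mass matrix M, boundary restriction matrix R, boundary matrix B, and normal matrices N_x, N_y, such that moreover R is multiplicative on grid functions (R(a∘c) = (Ra)∘(Rc) for all grid functions a, c) and the matrices B N_x and B N_y are diagonal, and the differentiable time-dependent grid functions h, u, v, w, η (with h(t) componentwise positive) satisfy the semidiscretization for all t, then the total discrete energy 𝟏ᵀ M E(t), with E = h ∘ ((u² + v²)/2 + w²/6 + (g/2)(h + 2b) + (λ/6)(η/h − 𝟏)²), is constant in time, i.e., its time derivative vanishes at every time t. -/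
open Matrix

section SummationByParts

variable {ι κ : Type*} [Fintype ι] [Fintype κ]

/-- A diagonal boundary form composed with a multiplicative restriction depends only on the
product of its two arguments. -/
lemma dotProduct_boundary_eq_of_mul_eq {R : Matrix κ ι ℝ} {C : Matrix κ κ ℝ}
    (hR : ∀ a c : ι → ℝ, R *ᵥ (a * c) = (R *ᵥ a) * (R *ᵥ c)) (hC : C.IsDiag)
    {a c p q : ι → ℝ} (hac : a * c = p * q) :
    a ⬝ᵥ ((Rᵀ * C * R) *ᵥ c) = p ⬝ᵥ ((Rᵀ * C * R) *ᵥ q) := by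
  classical
  have key : ∀ x y : ι → ℝ, x ⬝ᵥ ((Rᵀ * C * R) *ᵥ y) = ∑ k, C k k * (R *ᵥ (x * y)) k := by
    intro x y
    rw [← mulVec_mulVec, ← mulVec_mulVec, dotProduct_mulVec, vecMul_transpose,
      ← hC.diagonal_diag, dotProduct]
    refine Finset.sum_congr rfl fun k _ => ?_
    rw [mulVec_diagonal, hR, Pi.mul_apply, diagonal_apply_eq]
    ring
  rw [key, key, hac]

variable [DecidableEq ι]

lemma sum_sbp_sub_boundary_eq_zero {M D : Matrix ι ι ℝ} {R : Matrix κ ι ℝ} {C : Matrix κ κ ℝ}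
    (hM : M.IsDiag) (hMpd : M.PosDef) (hSBP : M * D + Dᵀ * M = Rᵀ * C * R)
    (hR : ∀ a c : ι → ℝ, R *ᵥ (a * c) = (R *ᵥ a) * (R *ᵥ c)) (hC : C.IsDiag)
    {a c p q : ι → ℝ} (hac : a * c = p * q) :
    ∑ i, M i i * (a i * (D *ᵥ c) i + c i * (D *ᵥ a) i
      - p i * (M⁻¹ *ᵥ ((Rᵀ * C * R) *ᵥ q)) i) = 0 := by
  have hdiag : ∀ x y : ι → ℝ, ∑ i, M i i * (x i * y i) = x ⬝ᵥ (M *ᵥ y) := by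
    intro x y
    conv_rhs => rw [← hM.diagonal_diag]
    refine Finset.sum_congr rfl fun i _ => ?_
    rw [mulVec_diagonal, diag_apply]
    ring
  have hinv : M *ᵥ (M⁻¹ *ᵥ ((Rᵀ * C * R) *ᵥ q)) = (Rᵀ * C * R) *ᵥ q := by
    rw [mulVec_mulVec, mul_nonsing_inv _ ((isUnit_iff_isUnit_det M).1 hMpd.isUnit), one_mulVec]
  have hsymm : c ⬝ᵥ (M *ᵥ (D *ᵥ a)) = a ⬝ᵥ ((Dᵀ * M) *ᵥ c) := by
    rw [dotProduct_comm, mulVec_mulVec, dotProduct_mulVec, ← mulVec_transpose, transpose_mul,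
      transpose_transpose, hM.isSymm.eq]
  simp only [mul_sub, mul_add, Finset.sum_sub_distrib, Finset.sum_add_distrib, hdiag, hinv]
  rw [hsymm, mulVec_mulVec, ← dotProduct_add, ← add_mulVec, hSBP,
    dotProduct_boundary_eq_of_mul_eq hR hC hac, sub_self]

/-- The contribution of one coordinate direction to the discrete energy rate vanishes; `u` is the
velocity component in that direction and `v` the transverse one. -/
lemma sum_directional_energy_rate_eq_zero {M D : Matrix ι ι ℝ} {R : Matrix κ ι ℝ}
    {C : Matrix κ κ ℝ} (hM : M.IsDiag) (hMpd : M.PosDef)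
    (hSBP : M * D + Dᵀ * M = Rᵀ * C * R)
    (hR : ∀ a c : ι → ℝ, R *ᵥ (a * c) = (R *ᵥ a) * (R *ᵥ c)) (hC : C.IsDiag)
    (g lam : ℝ) (b u v w η : ι → ℝ) {h : ι → ℝ} (hpos : ∀ i, 0 < h i) :
    ∑ i, M i i * (
      ((u i ^ 2 + v i ^ 2) / 2 + w i ^ 2 / 6 + g * (h i + b i) + lam / 6 * (1 - (η i / h i) ^ 2))
        * ((M⁻¹ *ᵥ ((Rᵀ * C * R) *ᵥ (h * u))) i - u i * (D *ᵥ h) i - h i * (D *ᵥ u) i)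
      - u i * (g * (D *ᵥ (h * (h + b))) i - g * ((h i + b i) * (D *ᵥ h) i)
        + 1 / 2 * (h i * (D *ᵥ (u ^ 2)) i) - 1 / 2 * (u i ^ 2 * (D *ᵥ h) i)
        + 1 / 2 * (u i * (D *ᵥ (h * u)) i) - 1 / 2 * (h i * u i * (D *ᵥ u) i)
        + lam / 6 * ((η i / h i) ^ 2 * (D *ᵥ h) i) + lam / 3 * (D *ᵥ η) i
        - lam / 3 * (η i / h i * (D *ᵥ η) i) - lam / 6 * (D *ᵥ (η ^ 2 / h)) i
        + lam / 2 * ((1 - η i / h i) * (D *ᵥ b) i))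
      - v i * (1 / 2 * (D *ᵥ (h * u * v)) i - 1 / 2 * (u i * v i * (D *ᵥ h) i)
        + 1 / 2 * (h i * u i * (D *ᵥ v) i) - 1 / 2 * (h i * v i * (D *ᵥ u) i))
      - w i / 3 * (1 / 2 * (D *ᵥ (h * u * w)) i + 1 / 2 * (h i * u i * (D *ᵥ w) i)
        - 1 / 2 * (u i * w i * (D *ᵥ h) i) - 1 / 2 * (h i * w i * (D *ᵥ u) i))
      - lam / 3 * (η i / h i - 1) * (u i * (D *ᵥ η) i + 3 / 2 * (u i * (D *ᵥ b) i))) = 0 := by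
  have sbp := fun (a c p : ι → ℝ) (hac : a * c = p * (h * u)) =>
    sum_sbp_sub_boundary_eq_zero hM hMpd hSBP hR hC hac
  have gravity := sbp u (h * (h + b)) (h + b) (by ring)
  have normal := sbp (h * u) (u ^ 2) (u ^ 2) (by ring)
  have transverse := sbp v (h * u * v) (v ^ 2) (by ring)
  have vertical := sbp w (h * u * w) (w ^ 2) (by ring)
  have mass := sbp u h 1 (by ring)
  have relaxation := sbp u (η ^ 2 / h) ((η / h) ^ 2) (by
    ext i
    have := (hpos i).ne'
    simp only [Pi.mul_apply, Pi.div_apply, Pi.pow_apply]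
    field_simp)
  have combine := congrArg₂ (· + ·) (congrArg ((-g) * ·) gravity)
    (congrArg₂ (· + ·) (congrArg ((-1 / 2) * ·) normal)
    (congrArg₂ (· + ·) (congrArg ((-1 / 2) * ·) transverse)
    (congrArg₂ (· + ·) (congrArg ((-1 / 6) * ·) vertical)
    (congrArg₂ (· + ·) (congrArg ((-lam / 6) * ·) mass)
      (congrArg ((lam / 6) * ·) relaxation)))))
  simp only [Finset.mul_sum, ← Finset.sum_add_distrib, mul_zero, add_zero] at combine
  rw [← combine]
  refine Finset.sum_congr rfl fun i _ => ?_
  have := (hpos i).ne'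
  simp only [Pi.mul_apply, Pi.add_apply, Pi.div_apply, Pi.pow_apply, Pi.one_apply]
  field_simp
  ring

end SummationByParts

/-- The time derivative of the pointwise energy, with velocity rates entering as `h * u'`. -/
lemma hasDerivAt_energy_density {h u v w η : ℝ → ℝ} {h' u' v' w' η' t : ℝ} (g lam b : ℝ)
    (hh : HasDerivAt h h' t) (hu : HasDerivAt u u' t) (hv : HasDerivAt v v' t)
    (hw : HasDerivAt w w' t) (hη : HasDerivAt η η' t) (hne : h t ≠ 0) :
    HasDerivAt (fun s => h s * ((u s ^ 2 + v s ^ 2) / 2 + w s ^ 2 / 6 + g / 2 * (h s + 2 * b)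
        + lam / 6 * (η s / h s - 1) ^ 2))
      (((u t ^ 2 + v t ^ 2) / 2 + w t ^ 2 / 6 + g * (h t + b) + lam / 6 * (1 - (η t / h t) ^ 2))
          * h' + u t * (h t * u') + v t * (h t * v') + w t / 3 * (h t * w')
        + lam / 3 * (η t / h t - 1) * η') t := by
  refine (hh.fun_mul (((((hu.fun_pow 2).fun_add (hv.fun_pow 2)).div_const 2).fun_add
    ((hw.fun_pow 2).div_const 6)).fun_add ((hh.add_const (2 * b)).const_mul (g / 2)) |>.fun_add
    ((((hη.fun_div hh hne).sub_const 1).fun_pow 2).const_mul (lam / 6)))).congr_deriv ?_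
  simp only [Nat.cast_ofNat, Nat.add_one_sub_one, pow_one]
  field_simp
  ring

theorem reflecting_energy_conservation
    {ι : Type*} [Fintype ι] [DecidableEq ι] [Nonempty ι]
    {κ : Type*} [Fintype κ]
    (M Dx Dy : Matrix ι ι ℝ) (R : Matrix κ ι ℝ) (B Nx Ny : Matrix κ κ ℝ)
    (hMdiag : M.IsDiag) (hMpd : M.PosDef)
    (hSBPx : M * Dx + Dxᵀ * M = Rᵀ * B * Nx * R)
    (hSBPy : M * Dy + Dyᵀ * M = Rᵀ * B * Ny * R)
    (hRmul : ∀ a c : ι → ℝ, R *ᵥ (a * c) = (R *ᵥ a) * (R *ᵥ c))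
    (hBNx : (B * Nx).IsDiag) (hBNy : (B * Ny).IsDiag)
    (g lam : ℝ) (hg : 0 < g) (hlam : 0 ≤ lam) (b : ι → ℝ)
    (h u v w η h' u' v' w' η' : ℝ → ι → ℝ)
    (hdh : ∀ (t : ℝ) (i : ι), HasDerivAt (fun s => h s i) (h' t i) t)
    (hdu : ∀ (t : ℝ) (i : ι), HasDerivAt (fun s => u s i) (u' t i) t)
    (hdv : ∀ (t : ℝ) (i : ι), HasDerivAt (fun s => v s i) (v' t i) t)
    (hdw : ∀ (t : ℝ) (i : ι), HasDerivAt (fun s => w s i) (w' t i) t)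
    (hdη : ∀ (t : ℝ) (i : ι), HasDerivAt (fun s => η s i) (η' t i) t)
    (hpos : ∀ (t : ℝ) (i : ι), 0 < h t i)
    (heqh : ∀ t : ℝ, h' t = -(u t * (Dx *ᵥ h t) + h t * (Dx *ᵥ u t) + v t * (Dy *ᵥ h t) + h t * (Dy *ᵥ v t) - M⁻¹ *ᵥ ((Rᵀ * B * Nx * R) *ᵥ (h t * u t)) - M⁻¹ *ᵥ ((Rᵀ * B * Ny * R) *ᵥ (h t * v t))))
    (hequ : ∀ t : ℝ, h t * u' t = -(g • (Dx *ᵥ (h t * (h t + b))) - g • ((h t + b) * (Dx *ᵥ h t)) + (1/2 : ℝ) • (h t * (Dx *ᵥ (u t^2))) - (1/2 : ℝ) • (u t^2 * (Dx *ᵥ h t)) + (1/2 : ℝ) • (u t * (Dx *ᵥ (h t * u t))) - (1/2 : ℝ) • (h t * u t * (Dx *ᵥ u t)) + (1/2 : ℝ) • (Dy *ᵥ (h t * u t * v t)) - (1/2 : ℝ) • (u t * v t * (Dy *ᵥ h t)) + (1/2 : ℝ) • (h t * v t * (Dy *ᵥ u t)) - (1/2 : ℝ) • (h t * u t * (Dy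 *ᵥ v t)) + (lam/6) • ((η t^2 / h t^2) * (Dx *ᵥ h t)) + (lam/3) • (Dx *ᵥ η t) - (lam/3) • ((η t / h t) * (Dx *ᵥ η t)) - (lam/6) • (Dx *ᵥ (η t^2 / h t)) + (lam/2) • ((1 - η t / h t) * (Dx *ᵥ b))))
    (heqv : ∀ t : ℝ, h t * v' t = -(g • (Dy *ᵥ (h t * (h t + b))) - g • ((h t + b) * (Dy *ᵥ h t)) + (1/2 : ℝ) • (h t * (Dy *ᵥ (v t^2))) - (1/2 : ℝ) • (v t^2 * (Dy *ᵥ h t)) + (1/2 : ℝ) • (v t * (Dy *ᵥ (h t * v t))) - (1/2 : ℝ) • (h t * v t * (Dy *ᵥ v t)) + (1/2 : ℝ) • (Dx *ᵥ (h t * u t * v t)) - (1/2 : ℝ) • (u t * v t * (Dx *ᵥ h t)) + (1/2 : ℝ) • (h t * u t * (Dx *ᵥ v t)) - (1/2 : ℝ) • (h t * v t * (Dx *ᵥ u t)) + (lam/6) • ((η t^2 / h t^2) * (Dy *ᵥ h t)) + (lam/3) • (Dy *ᵥ η t) - (lam/3) • ((η t / h t) * (Dy *ᵥ η t)) - (lam/6)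 • (Dy *ᵥ (η t^2 / h t)) + (lam/2) • ((1 - η t / h t) * (Dy *ᵥ b))))
    (heqw : ∀ t : ℝ, h t * w' t = -((1/2 : ℝ) • (Dx *ᵥ (h t * u t * w t)) + (1/2 : ℝ) • (h t * u t * (Dx *ᵥ w t)) - (1/2 : ℝ) • (u t * w t * (Dx *ᵥ h t)) - (1/2 : ℝ) • (h t * w t * (Dx *ᵥ u t)) + (1/2 : ℝ) • (Dy *ᵥ (h t * v t * w t)) + (1/2 : ℝ) • (h t * v t * (Dy *ᵥ w t)) - (1/2 : ℝ) • (v t * w t * (Dy *ᵥ h t)) - (1/2 : ℝ) • (h t * w t * (Dy *ᵥ v t))) + lam • ((1 : ι → ℝ) - η t / h t))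
    (heqη : ∀ t : ℝ, η' t = -(u t * (Dx *ᵥ η t) + v t * (Dy *ᵥ η t) + (3/2 : ℝ) • (u t * (Dx *ᵥ b)) + (3/2 : ℝ) • (v t * (Dy *ᵥ b))) + w t) :
    ∀ t : ℝ, HasDerivAt (fun s => (1 : ι → ℝ) ⬝ᵥ (M *ᵥ (h s * ((u s^2 + v s^2)/2 + w s^2/6 + (g/2) • (h s + (2:ℝ) • b) + (lam/6) • (η s / h s - 1)^2)))) 0 t := by
  intro t
  rw [Matrix.mul_assoc Rᵀ B Nx] at hSBPx
  rw [Matrix.mul_assoc Rᵀ B Ny] at hSBPy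
  simp only [Matrix.mul_assoc Rᵀ B Nx, Matrix.mul_assoc Rᵀ B Ny] at heqh
  have henergy : ∀ f : ι → ℝ, (1 : ι → ℝ) ⬝ᵥ (M *ᵥ f) = ∑ i, M i i * f i := by
    intro f
    conv_lhs => rw [← hMdiag.diagonal_diag]
    simp [dotProduct, mulVec_diagonal]
  simp only [henergy]
  have hderiv := HasDerivAt.fun_sum (u := Finset.univ) fun i _ =>
    (hasDerivAt_energy_density g lam (b i) (hdh t i) (hdu t i) (hdv t i) (hdw t i) (hdη t i)
      (hpos t i).ne').const_mul (M i i)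
  have hx := sum_directional_energy_rate_eq_zero hMdiag hMpd hSBPx hRmul hBNx g lam b
    (u t) (v t) (w t) (η t) (hpos t)
  have hy := sum_directional_energy_rate_eq_zero hMdiag hMpd hSBPy hRmul hBNy g lam b
    (v t) (u t) (w t) (η t) (hpos t)
  have hxy := congrArg₂ (· + ·) hx hy
  simp only [← Finset.sum_add_distrib, add_zero] at hxy
  refine hderiv.congr_deriv ?_
  rw [← hxy]
  refine Finset.sum_congr rfl fun i _ => ?_
  have eh := congrFun (heqh t) i
  have eu := congrFun (hequ t) i
  have ev := congrFun (heqv t) i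
  have ew := congrFun (heqw t) i
  have eη := congrFun (heqη t) i
  rw [mul_right_comm (h t) (v t) (u t)]
  simp only [Pi.mul_apply, Pi.add_apply, Pi.sub_apply, Pi.neg_apply, Pi.smul_apply, Pi.div_apply,
    Pi.pow_apply, Pi.one_apply, smul_eq_mul, ← div_pow] at eh eu ev ew eη
  rw [eh, eu, ev, ew, eη]
  ring
end

section
/- For the split-form semidiscretization of the 2D shallow water equations with variable bathymetry and weakly enforced reflecting boundary conditions (the λ = 0 case of the hyperbolic Serre–Green–Naghdi semidiscretization): if D_x and D_y are non-periodic first-derivative SBP operators with common diagonal positive-definite mass matrix M, boundary restriction matrix R, boundary matrix B, and normal matrices N_x, N_y, such that moreover R is multiplicative on grid functions (R(a∘c) = (Ra)∘(Rc) for all grid functions a, c) and the matrices B N_x and B N_y are diagonal, and the differentiable time-dependent grid functions h, u, v satisfy the shallow water semidiscretization with simultaneous approximation terms for all t, then the total discrete energy 𝟏ᵀ M E_SW(t), with E_SW = (g/2) h² + g h∘b + (1/2) h∘(u² + v²), is constant in time, i.e., its time derivative vanishes at every time t. -/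
open Matrix

namespace Matrix

variable {ι κ : Type*} [Fintype ι] [Fintype κ]

lemma IsDiag.dotProduct_mulVec [DecidableEq κ] {C : Matrix κ κ ℝ} (hC : C.IsDiag) (a c : κ → ℝ) :
    a ⬝ᵥ (C *ᵥ c) = C.diag ⬝ᵥ (a * c) := by
  conv_lhs => rw [← hC.diagonal_diag]
  simp only [dotProduct, mulVec_diagonal, Pi.mul_apply]
  exact Finset.sum_congr rfl fun i _ => by ring

/-- A boundary form with multiplicative restriction and diagonal weight depends only on the product
of its arguments. -/
lemma boundaryForm_eq_of_mul_eq {R : Matrix κ ι ℝ} {C : Matrix κ κ ℝ}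
    (hR : ∀ a c : ι → ℝ, R *ᵥ (a * c) = (R *ᵥ a) * (R *ᵥ c)) (hC : C.IsDiag)
    {a c k m : ι → ℝ} (hprod : a * c = k * m) :
    a ⬝ᵥ ((Rᵀ * C * R) *ᵥ c) = k ⬝ᵥ ((Rᵀ * C * R) *ᵥ m) := by
  classical
  have key (x y : ι → ℝ) : x ⬝ᵥ ((Rᵀ * C * R) *ᵥ y) = C.diag ⬝ᵥ (R *ᵥ (x * y)) := by
    rw [hR, ← hC.dotProduct_mulVec, ← mulVec_mulVec, ← mulVec_mulVec, Matrix.dotProduct_mulVec x,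
      vecMul_transpose]
  rw [key, key, hprod]

/-- Summation by parts for a mass matrix `diagonal w`, with the boundary term evaluated at any
factorization of the same product. -/
lemma sum_by_parts_eq_zero [DecidableEq ι] {w : ι → ℝ} {D : Matrix ι ι ℝ}
    {R : Matrix κ ι ℝ} {C : Matrix κ κ ℝ}
    (hD : diagonal w * D + Dᵀ * diagonal w = Rᵀ * C * R)
    (hR : ∀ a c : ι → ℝ, R *ᵥ (a * c) = (R *ᵥ a) * (R *ᵥ c)) (hC : C.IsDiag)
    {a c k m : ι → ℝ} (hprod : a * c = k * m) :
    ∑ i, (w i * (a i * (D *ᵥ c) i + c i * (D *ᵥ a) i) - k i * ((Rᵀ * C * R) *ᵥ m) i) = 0 := by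
  have hb := boundaryForm_eq_of_mul_eq hR hC hprod
  rw [← hD, add_mulVec, dotProduct_add, ← mulVec_mulVec, ← mulVec_mulVec,
    Matrix.dotProduct_mulVec a Dᵀ, vecMul_transpose, hD] at hb
  simp only [dotProduct, mulVec_diagonal] at hb
  rw [Finset.sum_sub_distrib, ← hb, ← Finset.sum_add_distrib, ← Finset.sum_sub_distrib]
  exact Finset.sum_eq_zero fun i _ => by ring

/-- The split-form shallow water terms in one coordinate direction, with normal velocity `n` and
tangential velocity `τ`, do not change the total energy. -/
lemma splitForm_energy_balance [DecidableEq ι] {w : ι → ℝ} {D : Matrix ι ι ℝ}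
    {R : Matrix κ ι ℝ} {C : Matrix κ κ ℝ}
    (hD : diagonal w * D + Dᵀ * diagonal w = Rᵀ * C * R)
    (hR : ∀ a c : ι → ℝ, R *ᵥ (a * c) = (R *ᵥ a) * (R *ᵥ c)) (hC : C.IsDiag)
    (g : ℝ) (b h n τ : ι → ℝ) :
    ∑ i, ((g * (h i + b i) + 1 / 2 * (n i ^ 2 + τ i ^ 2)) *
          (((Rᵀ * C * R) *ᵥ (h * n)) i - w i * (n i * (D *ᵥ h) i + h i * (D *ᵥ n) i))
        - w i * n i * (g * (D *ᵥ (h * (h + b))) i - g * ((h i + b i) * (D *ᵥ h) i)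
          + 1 / 2 * (h i * (D *ᵥ (n ^ 2)) i) - 1 / 2 * (n i ^ 2 * (D *ᵥ h) i)
          + 1 / 2 * (n i * (D *ᵥ (h * n)) i) - 1 / 2 * (h i * n i * (D *ᵥ n) i))
        - w i * τ i * (1 / 2 * (D *ᵥ (h * n * τ)) i - 1 / 2 * (n i * τ i * (D *ᵥ h) i)
          + 1 / 2 * (h i * n i * (D *ᵥ τ) i) - 1 / 2 * (h i * τ i * (D *ᵥ n) i))) = 0 := by
  have pressure := sum_by_parts_eq_zero hD hR hC
    (show n * (h * (h + b)) = (h + b) * (h * n) by ring)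
  have normal := sum_by_parts_eq_zero hD hR hC (show n ^ 2 * (h * n) = n ^ 2 * (h * n) from rfl)
  have tangential := sum_by_parts_eq_zero hD hR hC
    (show τ * (h * n * τ) = τ ^ 2 * (h * n) by ring)
  have := congrArg₂ (· + ·) (congrArg (-g * ·) pressure)
    (congrArg (-(1 / 2) * ·) (congrArg₂ (· + ·) normal tangential))
  simp only [Finset.mul_sum, ← Finset.sum_add_distrib, mul_zero, add_zero] at this
  rw [← this]
  refine Finset.sum_congr rfl fun i _ => ?_
  simp only [Pi.mul_apply, Pi.add_apply, Pi.pow_apply]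
  ring

end Matrix

theorem reflecting_shallow_water_energy_conservation
    {ι : Type*} [Fintype ι] [DecidableEq ι] [Nonempty ι]
    {κ : Type*} [Fintype κ]
    (M Dx Dy : Matrix ι ι ℝ) (R : Matrix κ ι ℝ) (B Nx Ny : Matrix κ κ ℝ)
    (hMdiag : M.IsDiag) (hMpd : M.PosDef)
    (hSBPx : M * Dx + Dxᵀ * M = Rᵀ * B * Nx * R)
    (hSBPy : M * Dy + Dyᵀ * M = Rᵀ * B * Ny * R)
    (hRmul : ∀ a c : ι → ℝ, R *ᵥ (a * c) = (R *ᵥ a) * (R *ᵥ c))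
    (hBNx : (B * Nx).IsDiag) (hBNy : (B * Ny).IsDiag)
    (g : ℝ) (hg : 0 < g) (b : ι → ℝ)
    (h u v h' u' v' : ℝ → ι → ℝ)
    (hdh : ∀ (t : ℝ) (i : ι), HasDerivAt (fun s => h s i) (h' t i) t)
    (hdu : ∀ (t : ℝ) (i : ι), HasDerivAt (fun s => u s i) (u' t i) t)
    (hdv : ∀ (t : ℝ) (i : ι), HasDerivAt (fun s => v s i) (v' t i) t)
    (heqh : ∀ t : ℝ, h' t = -(u t * (Dx *ᵥ h t) + h t * (Dx *ᵥ u t) + v t * (Dy *ᵥ h t) + h t * (Dy *ᵥ v t) - M⁻¹ *ᵥ ((Rᵀ * B * Nx * R) *ᵥ (h t * u t)) - M⁻¹ *ᵥ ((Rᵀ * B * Ny * R) *ᵥ (h t * v t))))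
    (hequ : ∀ t : ℝ, h t * u' t = -(g • (Dx *ᵥ (h t * (h t + b))) - g • ((h t + b) * (Dx *ᵥ h t)) + (1/2 : ℝ) • (h t * (Dx *ᵥ (u t^2))) - (1/2 : ℝ) • (u t^2 * (Dx *ᵥ h t)) + (1/2 : ℝ) • (u t * (Dx *ᵥ (h t * u t))) - (1/2 : ℝ) • (h t * u t * (Dx *ᵥ u t)) + (1/2 : ℝ) • (Dy *ᵥ (h t * u t * v t)) - (1/2 : ℝ) • (u t * v t * (Dy *ᵥ h t)) + (1/2 : ℝ) • (h t * v t * (Dy *ᵥ u t)) - (1/2 : ℝ) • (h t * u t * (Dy *ᵥ v t))))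
    (heqv : ∀ t : ℝ, h t * v' t = -(g • (Dy *ᵥ (h t * (h t + b))) - g • ((h t + b) * (Dy *ᵥ h t)) + (1/2 : ℝ) • (h t * (Dy *ᵥ (v t^2))) - (1/2 : ℝ) • (v t^2 * (Dy *ᵥ h t)) + (1/2 : ℝ) • (v t * (Dy *ᵥ (h t * v t))) - (1/2 : ℝ) • (h t * v t * (Dy *ᵥ v t)) + (1/2 : ℝ) • (Dx *ᵥ (h t * u t * v t)) - (1/2 : ℝ) • (u t * v t * (Dx *ᵥ h t)) + (1/2 : ℝ) • (h t * u t * (Dx *ᵥ v t)) - (1/2 : ℝ) • (h t * v t * (Dx *ᵥ u t)))) :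
    ∀ t : ℝ, HasDerivAt (fun s => (1 : ι → ℝ) ⬝ᵥ (M *ᵥ ((g/2) • (h s^2) + g • (h s * b) + (1/2 : ℝ) • (h s * (u s^2 + v s^2))))) 0 t := by
  intro t
  have hunit : IsUnit M.det := (Matrix.isUnit_iff_isUnit_det M).1 hMpd.isUnit
  obtain ⟨w, rfl⟩ : ∃ w, M = diagonal w := ⟨M.diag, hMdiag.diagonal_diag.symm⟩
  have hinv (q : ι → ℝ) (i : ι) : w i * ((diagonal w)⁻¹ *ᵥ q) i = q i := by
    rw [← mulVec_diagonal, mulVec_mulVec, Matrix.mul_nonsing_inv _ hunit, one_mulVec]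
  rw [Matrix.mul_assoc Rᵀ] at hSBPx hSBPy
  simp only [Matrix.mul_assoc Rᵀ B] at heqh
  have balance_x := splitForm_energy_balance hSBPx hRmul hBNx g b (h t) (u t) (v t)
  have balance_y := splitForm_energy_balance hSBPy hRmul hBNy g b (h t) (v t) (u t)
  simp only [dotProduct, mulVec_diagonal, Pi.one_apply, one_mul, Pi.add_apply, Pi.smul_apply,
    Pi.mul_apply, Pi.pow_apply, smul_eq_mul]
  have hderiv : HasDerivAt (fun s => ∑ i, w i * (g / 2 * h s i ^ 2 + g * (h s i * b i)
      + 1 / 2 * (h s i * (u s i ^ 2 + v s i ^ 2))))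
      (∑ i, w i * ((g * (h t i + b i) + 1 / 2 * (u t i ^ 2 + v t i ^ 2)) * h' t i
        + u t i * (h t i * u' t i) + v t i * (h t i * v' t i))) t := by
    refine HasDerivAt.fun_sum fun i _ => HasDerivAt.const_mul (w i) ?_
    have Hh := hdh t i
    have Hu := hdu t i
    have Hv := hdv t i
    refine ((((Hh.fun_pow 2).const_mul (g / 2)).fun_add ((Hh.mul_const (b i)).const_mul g)).fun_add
      ((Hh.fun_mul ((Hu.fun_pow 2).fun_add (Hv.fun_pow 2))).const_mul (1 / 2))).congr_deriv ?_
    push_cast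
    ring
  convert hderiv using 1
  rw [← add_zero (0 : ℝ)]
  nth_rewrite 1 [← balance_x]
  rw [← balance_y, ← Finset.sum_add_distrib]
  refine Finset.sum_congr rfl fun i _ => ?_
  have eh := congrFun (heqh t) i
  have eu := congrFun (hequ t) i
  have ev := congrFun (heqv t) i
  rw [mul_right_comm (h t) (v t) (u t)]
  simp only [Pi.add_apply, Pi.smul_apply, Pi.sub_apply, Pi.neg_apply,
    Pi.mul_apply, Pi.pow_apply, smul_eq_mul] at eh eu ev
  rw [eh, eu, ev, ← hinv ((Rᵀ * (B * Nx) * R) *ᵥ (h t * u t)) i,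
    ← hinv ((Rᵀ * (B * Ny) * R) *ᵥ (h t * v t)) i]
  ring
end

section
/- Non-hydrostatic cancellation identity (periodic case): let D_x, D_y be periodic first-derivative SBP operators with common diagonal positive-definite mass matrix M, let λ ≥ 0, and let h, u, v, w, η, b be grid functions with h componentwise nonzero. Then the following sum vanishes: 𝟏ᵀM[(w²/6 + (λ/6)(𝟏 − η²/h²)) ∘ (u∘D_x h + h∘D_x u + v∘D_y h + h∘D_y v)] + uᵀM[(λ/6)(η²/h²)∘D_x h + (λ/3)D_x η − (λ/3)(η/h)∘D_x η − (λ/6)D_x(η²/h) + (λ/2)(𝟏 − η/h)∘D_x b] + vᵀM[(λ/6)(η²/h²)∘D_y h + (λ/3)D_y η − (λ/3)(η/h)∘D_y η − (λ/6)D_y(η²/h) + (λ/2)(𝟏 − η/h)∘D_y b] + (1/3)wᵀM[(1/2)D_x(h∘u∘w) + (1/2)h∘u∘D_x w − (1/2)u∘w∘D_x h − (1/2)h∘w∘D_x u + (1/2)D_y(h∘v∘w) + (1/2)h∘v∘D_y w − (1/2)v∘w∘D_y h − (1/2)h∘w∘D_y v − λ(𝟏 − η/h)] − (λ/3)(𝟏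 − η/h)ᵀM[u∘D_x η + v∘D_y η + (3/2)u∘D_x b + (3/2)v∘D_y b − w] = 0. -/
open Matrix

/-- Discrete integration by parts for a periodic summation-by-parts operator with diagonal mass
matrix. -/
theorem sum_sbp_diagonal {ι : Type*} [Fintype ι] [DecidableEq ι] {m : ι → ℝ} {D : Matrix ι ι ℝ}
    (hD : diagonal m * D + Dᵀ * diagonal m = 0) (f g : ι → ℝ) :
    ∑ i, m i * (f i * (D *ᵥ g) i + g i * (D *ᵥ f) i) = 0 := by
  have hfg : f ⬝ᵥ ((diagonal m * D + Dᵀ * diagonal m) *ᵥ g) = 0 := by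
    rw [hD, zero_mulVec, dotProduct_zero]
  rw [add_mulVec, dotProduct_add, ← mulVec_mulVec, ← mulVec_mulVec, dotProduct_mulVec f Dᵀ,
    vecMul_transpose] at hfg
  simp only [dotProduct, mulVec_diagonal, ← Finset.sum_add_distrib] at hfg
  rw [← hfg]
  exact Finset.sum_congr rfl fun i _ => by ring

theorem nhs_cancellation_periodic
    {ι : Type*} [Fintype ι] [DecidableEq ι] [Nonempty ι]
    (M Dx Dy : Matrix ι ι ℝ)
    (hMdiag : M.IsDiag) (hMpd : M.PosDef)
    (hSBPx : M * Dx + Dxᵀ * M = 0) (hSBPy : M * Dy + Dyᵀ * M = 0)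
    (lam : ℝ) (hlam : 0 ≤ lam)
    (h u v w η b : ι → ℝ) (hpos : ∀ i, h i ≠ 0) :
    (1 : ι → ℝ) ⬝ᵥ (M *ᵥ ((w^2/6 + (lam/6) • (1 - η^2/h^2)) * (u * (Dx *ᵥ h) + h * (Dx *ᵥ u) + v * (Dy *ᵥ h) + h * (Dy *ᵥ v))))
      + u ⬝ᵥ (M *ᵥ ((lam/6) • ((η^2 / h^2) * (Dx *ᵥ h)) + (lam/3) • (Dx *ᵥ η) - (lam/3) • ((η / h) * (Dx *ᵥ η)) - (lam/6) • (Dx *ᵥ (η^2 / h)) + (lam/2) • ((1 - η / h) * (Dx *ᵥ b))))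
      + v ⬝ᵥ (M *ᵥ ((lam/6) • ((η^2 / h^2) * (Dy *ᵥ h)) + (lam/3) • (Dy *ᵥ η) - (lam/3) • ((η / h) * (Dy *ᵥ η)) - (lam/6) • (Dy *ᵥ (η^2 / h)) + (lam/2) • ((1 - η / h) * (Dy *ᵥ b))))
      + (1/3 : ℝ) * (w ⬝ᵥ (M *ᵥ ((1/2 : ℝ) • (Dx *ᵥ (h * u * w)) + (1/2 : ℝ) • (h * u * (Dx *ᵥ w)) - (1/2 : ℝ) • (u * w * (Dx *ᵥ h)) - (1/2 : ℝ) • (h * w * (Dx *ᵥ u)) + (1/2 : ℝ) • (Dy *ᵥ (h * v * w)) + (1/2 : ℝ) • (h * v * (Dy *ᵥ w)) - (1/2 : ℝ) • (v * w * (Dy *ᵥ h)) - (1/2 : ℝ) • (h * w * (Dy *ᵥ v)) - lam • ((1 : ι → ℝ) - η/h))))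
      - (lam/3) * (((1 : ι → ℝ) - η/h) ⬝ᵥ (M *ᵥ (u * (Dx *ᵥ η) + v * (Dy *ᵥ η) + (3/2 : ℝ) • (u * (Dx *ᵥ b)) + (3/2 : ℝ) • (v * (Dy *ᵥ b)) - w)))
      = 0 := by
  obtain ⟨m, rfl⟩ : ∃ m, M = diagonal m := ⟨M.diag, hMdiag.diagonal_diag.symm⟩
  have hx := sum_sbp_diagonal hSBPx
  have hy := sum_sbp_diagonal hSBPy
  suffices hsum : _ = (1 / 6 : ℝ) * ∑ i, m i * (w i * (Dx *ᵥ (h * u * w)) i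
          + (h * u * w) i * (Dx *ᵥ w) i)
        + lam / 6 * ∑ i, m i * (u i * (Dx *ᵥ h) i + h i * (Dx *ᵥ u) i)
        - lam / 6 * ∑ i, m i * (u i * (Dx *ᵥ (η ^ 2 / h)) i + (η ^ 2 / h) i * (Dx *ᵥ u) i)
        + (1 / 6 : ℝ) * ∑ i, m i * (w i * (Dy *ᵥ (h * v * w)) i + (h * v * w) i * (Dy *ᵥ w) i)
        + lam / 6 * ∑ i, m i * (v i * (Dy *ᵥ h) i + h i * (Dy *ᵥ v) i)
        - lam / 6 * ∑ i, m i * (v i * (Dy *ᵥ (η ^ 2 / h)) i + (η ^ 2 / h) i * (Dy *ᵥ v) i) by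
    simpa only [hx, hy, mul_zero, add_zero, sub_zero] using hsum
  simp only [dotProduct, mulVec_diagonal, Finset.mul_sum, ← Finset.sum_add_distrib,
    ← Finset.sum_sub_distrib]
  refine Finset.sum_congr rfl fun i _ => ?_
  have hi := hpos i
  simp only [Pi.add_apply, Pi.sub_apply, Pi.mul_apply, Pi.div_apply, Pi.pow_apply, Pi.smul_apply,
    Pi.ofNat_apply, smul_eq_mul]
  field_simp
  ring
end

section
/- Non-hydrostatic cancellation identity (reflecting case): let D_x, D_y be non-periodic first-derivative SBP operators with common diagonal positive-definite mass matrix M, boundary restriction matrix R, boundary matrix B, and normal matrices N_x, N_y, such that R is multiplicative on grid functions (R(a∘c) = (Ra)∘(Rc) for all grid functions a, c) and B N_x, B N_y are diagonal; let λ ≥ 0, and let h, u, v, w, η, b be grid functions with h componentwise nonzero. Then the following sum vanishes: 𝟏ᵀM[(w²/6 + (λ/6)(𝟏 − η²/h²)) ∘ (u∘D_x h + h∘D_x u + v∘D_y h + h∘D_y v − M⁻¹RᵀBN_xR(h∘u) − M⁻¹RᵀBN_yR(h∘v))] + uᵀM[(λ/6)(η²/h²)∘D_x h + (λ/3)D_x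 η − (λ/3)(η/h)∘D_x η − (λ/6)D_x(η²/h) + (λ/2)(𝟏 − η/h)∘D_x b] + vᵀM[(λ/6)(η²/h²)∘D_y h + (λ/3)D_y η − (λ/3)(η/h)∘D_y η − (λ/6)D_y(η²/h) + (λ/2)(𝟏 − η/h)∘D_y b] + (1/3)wᵀM[(1/2)D_x(h∘u∘w) + (1/2)h∘u∘D_x w − (1/2)u∘w∘D_x h − (1/2)h∘w∘D_x u + (1/2)D_y(h∘v∘w) + (1/2)h∘v∘D_y w − (1/2)v∘w∘D_y h − (1/2)h∘w∘D_y v − λ(𝟏 − η/h)] − (λ/3)(𝟏 − η/h)ᵀM[u∘D_x η + v∘D_y η + (3/2)u∘D_x b + (3/2)v∘D_y b − w] = 0. -/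
open Matrix

/-- A bilinear form assembled from a diagonal boundary matrix and a multiplicative restriction
depends only on the componentwise product of its arguments. -/
lemma dotProduct_boundary_mulVec_congr {ι κ : Type*} [Fintype ι] [Fintype κ]
    {R : Matrix κ ι ℝ} {B N : Matrix κ κ ℝ}
    (hR : ∀ a c : ι → ℝ, R *ᵥ (a * c) = (R *ᵥ a) * (R *ᵥ c)) (hBN : (B * N).IsDiag)
    {a c f p : ι → ℝ} (hac : a * c = f * p) :
    a ⬝ᵥ ((Rᵀ * B * N * R) *ᵥ c) = f ⬝ᵥ ((Rᵀ * B * N * R) *ᵥ p) := by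
  classical
  have key (x y : ι → ℝ) : x ⬝ᵥ ((Rᵀ * B * N * R) *ᵥ y)
      = ∑ k, (B * N) k k * (R *ᵥ (x * y)) k := by
    rw [Matrix.mul_assoc Rᵀ B N, ← mulVec_mulVec, ← mulVec_mulVec, dotProduct_mulVec,
      vecMul_transpose, ← hBN.diagonal_diag, hR]
    simp only [dotProduct, mulVec_diagonal, diag_apply, Pi.mul_apply, diagonal_apply_eq]
    exact Finset.sum_congr rfl fun k _ => by ring
  rw [key, key, hac]

lemma Matrix.IsDiag.mulVec_apply {ι : Type*} [Fintype ι] {M : Matrix ι ι ℝ}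
    (hM : M.IsDiag) (x : ι → ℝ) (i : ι) : (M *ᵥ x) i = M i i * x i := by
  classical
  conv_lhs => rw [← hM.diagonal_diag]
  rw [mulVec_diagonal, diag_apply]

/-- Summation by parts for a diagonal mass matrix, with the boundary term expressed through its
lifting to the grid. -/
lemma sbp_sum_eq_lift {ι κ : Type*} [Fintype ι] [DecidableEq ι] [Fintype κ]
    {M D : Matrix ι ι ℝ} {R : Matrix κ ι ℝ} {B N : Matrix κ κ ℝ}
    (hM : M.IsDiag) (hMpd : M.PosDef)
    (hSBP : M * D + Dᵀ * M = Rᵀ * B * N * R)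
    (hR : ∀ a c : ι → ℝ, R *ᵥ (a * c) = (R *ᵥ a) * (R *ᵥ c)) (hBN : (B * N).IsDiag)
    {a c f p : ι → ℝ} (hac : a * c = f * p) :
    ∑ i, M i i * (a i * (D *ᵥ c) i + c i * (D *ᵥ a) i
      - f i * (M⁻¹ *ᵥ ((Rᵀ * B * N * R) *ᵥ p)) i) = 0 := by
  have hlift : M *ᵥ (M⁻¹ *ᵥ ((Rᵀ * B * N * R) *ᵥ p)) = (Rᵀ * B * N * R) *ᵥ p := by
    rw [mulVec_mulVec, Matrix.mul_nonsing_inv _ ((isUnit_iff_isUnit_det M).mp hMpd.isUnit),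
      one_mulVec]
  have hE := dotProduct_boundary_mulVec_congr hR hBN hac
  rw [← hlift, ← hSBP, add_mulVec, dotProduct_add, ← mulVec_mulVec, ← mulVec_mulVec,
    dotProduct_mulVec a Dᵀ, vecMul_transpose] at hE
  simp only [dotProduct, hM.mulVec_apply] at hE
  rw [← sub_eq_zero, ← Finset.sum_add_distrib, ← Finset.sum_sub_distrib] at hE
  rw [← hE, hSBP]
  exact Finset.sum_congr rfl fun i _ => by ring

theorem nhs_cancellation_reflecting
    {ι : Type*} [Fintype ι] [DecidableEq ι] [Nonempty ι]
    {κ : Type*} [Fintype κ]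
    (M Dx Dy : Matrix ι ι ℝ) (R : Matrix κ ι ℝ) (B Nx Ny : Matrix κ κ ℝ)
    (hMdiag : M.IsDiag) (hMpd : M.PosDef)
    (hSBPx : M * Dx + Dxᵀ * M = Rᵀ * B * Nx * R)
    (hSBPy : M * Dy + Dyᵀ * M = Rᵀ * B * Ny * R)
    (hRmul : ∀ a c : ι → ℝ, R *ᵥ (a * c) = (R *ᵥ a) * (R *ᵥ c))
    (hBNx : (B * Nx).IsDiag) (hBNy : (B * Ny).IsDiag)
    (lam : ℝ) (hlam : 0 ≤ lam)
    (h u v w η b : ι → ℝ) (hpos : ∀ i, h i ≠ 0) :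
    (1 : ι → ℝ) ⬝ᵥ (M *ᵥ ((w^2/6 + (lam/6) • (1 - η^2/h^2)) * (u * (Dx *ᵥ h) + h * (Dx *ᵥ u) + v * (Dy *ᵥ h) + h * (Dy *ᵥ v) - M⁻¹ *ᵥ ((Rᵀ * B * Nx * R) *ᵥ (h * u)) - M⁻¹ *ᵥ ((Rᵀ * B * Ny * R) *ᵥ (h * v)))))
      + u ⬝ᵥ (M *ᵥ ((lam/6) • ((η^2 / h^2) * (Dx *ᵥ h)) + (lam/3) • (Dx *ᵥ η) - (lam/3) • ((η / h) * (Dx *ᵥ η)) - (lam/6) • (Dx *ᵥ (η^2 / h)) + (lam/2) • ((1 - η / h) * (Dx *ᵥ b))))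
      + v ⬝ᵥ (M *ᵥ ((lam/6) • ((η^2 / h^2) * (Dy *ᵥ h)) + (lam/3) • (Dy *ᵥ η) - (lam/3) • ((η / h) * (Dy *ᵥ η)) - (lam/6) • (Dy *ᵥ (η^2 / h)) + (lam/2) • ((1 - η / h) * (Dy *ᵥ b))))
      + (1/3 : ℝ) * (w ⬝ᵥ (M *ᵥ ((1/2 : ℝ) • (Dx *ᵥ (h * u * w)) + (1/2 : ℝ) • (h * u * (Dx *ᵥ w)) - (1/2 : ℝ) • (u * w * (Dx *ᵥ h)) - (1/2 : ℝ) • (h * w * (Dx *ᵥ u)) + (1/2 : ℝ) • (Dy *ᵥ (h * v * w)) + (1/2 : ℝ) • (h * v * (Dy *ᵥ w)) - (1/2 : ℝ) • (v * w * (Dy *ᵥ h)) - (1/2 : ℝ) • (h * w * (Dy *ᵥ v)) - lam • ((1 : ι → ℝ) - η/h))))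
      - (lam/3) * (((1 : ι → ℝ) - η/h) ⬝ᵥ (M *ᵥ (u * (Dx *ᵥ η) + v * (Dy *ᵥ η) + (3/2 : ℝ) • (u * (Dx *ᵥ b)) + (3/2 : ℝ) • (v * (Dy *ᵥ b)) - w)))
      = 0 := by
  have w_x := sbp_sum_eq_lift (a := w) (c := h * u * w) (f := w ^ 2) (p := h * u)
    hMdiag hMpd hSBPx hRmul hBNx (by ring)
  have w_y := sbp_sum_eq_lift (a := w) (c := h * v * w) (f := w ^ 2) (p := h * v)
    hMdiag hMpd hSBPy hRmul hBNy (by ring)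
  have h_x := sbp_sum_eq_lift (a := u) (c := h) (f := 1) (p := h * u)
    hMdiag hMpd hSBPx hRmul hBNx (by ring)
  have h_y := sbp_sum_eq_lift (a := v) (c := h) (f := 1) (p := h * v)
    hMdiag hMpd hSBPy hRmul hBNy (by ring)
  have hη (z : ι → ℝ) : z * (η ^ 2 / h) = η ^ 2 / h ^ 2 * (h * z) := by
    ext i
    have := hpos i
    simp only [Pi.mul_apply, Pi.div_apply, Pi.pow_apply]
    field_simp
  have η_x := sbp_sum_eq_lift hMdiag hMpd hSBPx hRmul hBNx (hη u)
  have η_y := sbp_sum_eq_lift hMdiag hMpd hSBPy hRmul hBNy (hη v)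
  have combine {s₁ s₂ s₃ s₄ s₅ s₆ : ℝ} (e₁ : s₁ = 0) (e₂ : s₂ = 0) (e₃ : s₃ = 0) (e₄ : s₄ = 0)
      (e₅ : s₅ = 0) (e₆ : s₆ = 0) :
      1 / 6 * s₁ + 1 / 6 * s₂ + lam / 6 * s₃ + lam / 6 * s₄ - lam / 6 * s₅ - lam / 6 * s₆ = 0 := by
    simp [*]
  refine Eq.trans ?_ (combine w_x w_y h_x h_y η_x η_y)
  simp only [dotProduct, hMdiag.mulVec_apply, Finset.mul_sum, ← Finset.sum_add_distrib,
    ← Finset.sum_sub_distrib]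
  refine Finset.sum_congr rfl fun i _ => ?_
  have hi := hpos i
  simp only [Pi.mul_apply, Pi.add_apply, Pi.sub_apply, Pi.div_apply, Pi.pow_apply,
    Pi.smul_apply, smul_eq_mul, Pi.ofNat_apply]
  field_simp
  ring
end

section
/- Shallow water cancellation identity (periodic case): let D_x, D_y be periodic first-derivative SBP operators with common diagonal positive-definite mass matrix M, let g > 0, and let h, u, v, b be arbitrary grid functions. Then the following sum vanishes: 𝟏ᵀM[(g h + g b + (1/2)u² + (1/2)v²) ∘ (u∘D_x h + h∘D_x u + v∘D_y h + h∘D_y v)] + uᵀM[g D_x(h∘(h+b)) − g(h+b)∘D_x h + (1/2)h∘D_x(u²) − (1/2)u²∘D_x h + (1/2)u∘D_x(h∘u) − (1/2)h∘u∘D_x u + (1/2)D_y(h∘u∘v) − (1/2)u∘v∘D_y h + (1/2)h∘v∘D_y u − (1/2)h∘u∘D_y v] + vᵀM[g D_y(h∘(h+b)) − g(h+b)∘D_y h + (1/2)h∘D_y(v²) − (1/2)v²∘D_y h + (1/2)v∘D_y(h∘v) − (1/2)h∘v∘D_y v + (1/2)D_x(h∘u∘v) − (1/2)u∘v∘D_x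 h + (1/2)h∘u∘D_x v − (1/2)h∘v∘D_x u] = 0. -/
open Matrix

/-- Discrete integration by parts for a periodic SBP operator `D` with diagonal mass matrix. -/
theorem sum_sbp_eq_zero {ι : Type*} [Fintype ι] [DecidableEq ι] {d : ι → ℝ} {D : Matrix ι ι ℝ}
    (hD : diagonal d * D + Dᵀ * diagonal d = 0) (a c : ι → ℝ) :
    ∑ i, d i * (a i * (D *ᵥ c) i + c i * (D *ᵥ a) i) = 0 := by
  have key : a ⬝ᵥ ((diagonal d * D + Dᵀ * diagonal d) *ᵥ c) = 0 := by
    rw [hD, zero_mulVec, dotProduct_zero]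
  rw [add_mulVec, dotProduct_add, ← mulVec_mulVec, ← mulVec_mulVec, dotProduct_mulVec a Dᵀ,
    vecMul_transpose] at key
  rw [← key]
  simp only [dotProduct, mulVec_diagonal, ← Finset.sum_add_distrib]
  exact Finset.sum_congr rfl fun i _ => by ring

theorem sw_cancellation_periodic
    {ι : Type*} [Fintype ι] [DecidableEq ι] [Nonempty ι]
    (M Dx Dy : Matrix ι ι ℝ)
    (hMdiag : M.IsDiag) (hMpd : M.PosDef)
    (hSBPx : M * Dx + Dxᵀ * M = 0) (hSBPy : M * Dy + Dyᵀ * M = 0)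
    (g : ℝ) (hg : 0 < g)
    (h u v b : ι → ℝ) :
    (1 : ι → ℝ) ⬝ᵥ (M *ᵥ ((g • h + g • b + u^2/2 + v^2/2) * (u * (Dx *ᵥ h) + h * (Dx *ᵥ u) + v * (Dy *ᵥ h) + h * (Dy *ᵥ v))))
      + u ⬝ᵥ (M *ᵥ (g • (Dx *ᵥ (h * (h + b))) - g • ((h + b) * (Dx *ᵥ h)) + (1/2 : ℝ) • (h * (Dx *ᵥ (u^2))) - (1/2 : ℝ) • (u^2 * (Dx *ᵥ h)) + (1/2 : ℝ) • (u * (Dx *ᵥ (h * u))) - (1/2 : ℝ) • (h * u * (Dx *ᵥ u)) + (1/2 : ℝ) • (Dy *ᵥ (h * u * v)) - (1/2 : ℝ) • (u * v * (Dy *ᵥ h)) + (1/2 : ℝ) • (h * v * (Dy *ᵥ u)) - (1/2 : ℝ) • (h * u * (Dy *ᵥ v))))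
      + v ⬝ᵥ (M *ᵥ (g • (Dy *ᵥ (h * (h + b))) - g • ((h + b) * (Dy *ᵥ h)) + (1/2 : ℝ) • (h * (Dy *ᵥ (v^2))) - (1/2 : ℝ) • (v^2 * (Dy *ᵥ h)) + (1/2 : ℝ) • (v * (Dy *ᵥ (h * v))) - (1/2 : ℝ) • (h * v * (Dy *ᵥ v)) + (1/2 : ℝ) • (Dx *ᵥ (h * u * v)) - (1/2 : ℝ) • (u * v * (Dx *ᵥ h)) + (1/2 : ℝ) • (h * u * (Dx *ᵥ v)) - (1/2 : ℝ) • (h * v * (Dx *ᵥ u))))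
      = 0 := by
  obtain ⟨d, rfl⟩ : ∃ d, M = diagonal d := ⟨M.diag, hMdiag.diagonal_diag.symm⟩
  have gravity_x := sum_sbp_eq_zero hSBPx u (h * (h + b))
  have gravity_y := sum_sbp_eq_zero hSBPy v (h * (h + b))
  have advection_x := sum_sbp_eq_zero hSBPx (h * u) (u ^ 2)
  have advection_y := sum_sbp_eq_zero hSBPy (h * v) (v ^ 2)
  have cross_x := sum_sbp_eq_zero hSBPx v (h * u * v)
  have cross_y := sum_sbp_eq_zero hSBPy u (h * u * v)
  have combination := congrArg₂ (g * · + (1 / 2) * ·)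
    (congrArg₂ (· + ·) gravity_x gravity_y)
    (congrArg₂ (· + ·) (congrArg₂ (· + ·) advection_x advection_y)
      (congrArg₂ (· + ·) cross_x cross_y))
  simp only [add_zero, mul_zero] at combination
  rw [← combination]
  simp only [dotProduct, mulVec_diagonal, ← Finset.sum_add_distrib, Finset.mul_sum]
  refine Finset.sum_congr rfl fun i _ => ?_
  simp only [Pi.add_apply, Pi.sub_apply, Pi.mul_apply, Pi.smul_apply, Pi.pow_apply, Pi.div_apply,
    Pi.ofNat_apply, smul_eq_mul]
  ring
end

section
/- Shallow water cancellation identity (reflecting case): let D_x, D_y be non-periodic first-derivative SBP operators with common diagonal positive-definite mass matrix M, boundary restriction matrix R, boundary matrix B, and normal matrices N_x, N_y, such that R is multiplicative on grid functions (R(a∘c) = (Ra)∘(Rc) for all grid functions a, c) and B N_x, B N_y are diagonal; let g > 0, and let h, u, v, b be arbitrary grid functions. Then the following sum vanishes: 𝟏ᵀM[(g h + g b + (1/2)u² + (1/2)v²) ∘ (u∘D_x h + h∘D_x u + v∘D_y h + h∘D_y v − M⁻¹RᵀBN_xR(h∘u) − M⁻¹RᵀBN_yR(h∘v))] + uᵀM[g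 D_x(h∘(h+b)) − g(h+b)∘D_x h + (1/2)h∘D_x(u²) − (1/2)u²∘D_x h + (1/2)u∘D_x(h∘u) − (1/2)h∘u∘D_x u + (1/2)D_y(h∘u∘v) − (1/2)u∘v∘D_y h + (1/2)h∘v∘D_y u − (1/2)h∘u∘D_y v] + vᵀM[g D_y(h∘(h+b)) − g(h+b)∘D_y h + (1/2)h∘D_y(v²) − (1/2)v²∘D_y h + (1/2)v∘D_y(h∘v) − (1/2)h∘v∘D_y v + (1/2)D_x(h∘u∘v) − (1/2)u∘v∘D_x h + (1/2)h∘u∘D_x v − (1/2)h∘v∘D_x u] = 0. -/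
open Matrix

namespace SummationByParts

variable {ι κ : Type*} [Fintype ι] [Fintype κ]

/-- If `B * N` is diagonal and `R` is multiplicative, factors can be moved between the two
arguments of the boundary form `Rᵀ B N R`. -/
theorem boundary_form_mul_left {R : Matrix κ ι ℝ} {B N : Matrix κ κ ℝ}
    (hR : ∀ a c : ι → ℝ, R *ᵥ (a * c) = (R *ᵥ a) * (R *ᵥ c)) (hBN : (B * N).IsDiag)
    (a c e : ι → ℝ) :
    (a * c) ⬝ᵥ ((Rᵀ * B * N * R) *ᵥ e) = a ⬝ᵥ ((Rᵀ * B * N * R) *ᵥ (c * e)) := by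
  classical
  have key (x y : ι → ℝ) : x ⬝ᵥ ((Rᵀ * B * N * R) *ᵥ y)
      = ∑ k, (B * N) k k * (R *ᵥ x) k * (R *ᵥ y) k := by
    rw [Matrix.mul_assoc Rᵀ B N, ← mulVec_mulVec, ← mulVec_mulVec, dotProduct_mulVec,
      vecMul_transpose]
    conv_lhs => rw [← hBN.diagonal_diag]
    simp only [dotProduct, mulVec_diagonal, diag_apply]
    exact Finset.sum_congr rfl fun k _ => by ring
  rw [key, key, hR, hR]
  exact Finset.sum_congr rfl fun k _ => by simp only [Pi.mul_apply]; ring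

/-- The summation-by-parts property for a diagonal mass matrix, as a pointwise sum. -/
theorem dotProduct_boundary_mulVec [DecidableEq ι] {d : ι → ℝ} {D Q : Matrix ι ι ℝ}
    (hD : diagonal d * D + Dᵀ * diagonal d = Q) (a c : ι → ℝ) :
    a ⬝ᵥ (Q *ᵥ c) = ∑ i, d i * (a i * (D *ᵥ c) i + (D *ᵥ a) i * c i) := by
  rw [← hD, add_mulVec, dotProduct_add, ← mulVec_mulVec, ← mulVec_mulVec, dotProduct_mulVec a Dᵀ,
    vecMul_transpose]
  simp only [dotProduct, mulVec_diagonal, ← Finset.sum_add_distrib]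
  exact Finset.sum_congr rfl fun i _ => by ring

/-- The boundary contribution of the mass flux `h * w` in a direction with velocity `w` and
transversal velocity `z`, expressed through volume terms. -/
theorem energy_boundary_term [DecidableEq ι] {d : ι → ℝ} {D : Matrix ι ι ℝ} {R : Matrix κ ι ℝ}
    {B N : Matrix κ κ ℝ} (hD : diagonal d * D + Dᵀ * diagonal d = Rᵀ * B * N * R)
    (hR : ∀ a c : ι → ℝ, R *ᵥ (a * c) = (R *ᵥ a) * (R *ᵥ c)) (hBN : (B * N).IsDiag)
    (g : ℝ) (h w z b : ι → ℝ) :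
    (g • (h + b) + (1 / 2 : ℝ) • w ^ 2 + (1 / 2 : ℝ) • z ^ 2) ⬝ᵥ
        ((Rᵀ * B * N * R) *ᵥ (h * w)) =
      ∑ i, d i * (g * (w i * (D *ᵥ (h * (h + b))) i + (D *ᵥ w) i * (h i * (h i + b i)))
        + 1 / 2 * (h i * w i * (D *ᵥ (w ^ 2)) i + w i ^ 2 * (D *ᵥ (h * w)) i)
        + 1 / 2 * (z i * (D *ᵥ (h * w * z)) i + (D *ᵥ z) i * (h i * w i * z i))) := by
  have hg : (h + b) ⬝ᵥ ((Rᵀ * B * N * R) *ᵥ (h * w)) =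
      (h * (h + b)) ⬝ᵥ ((Rᵀ * B * N * R) *ᵥ w) := by
    rw [mul_comm h (h + b), boundary_form_mul_left hR hBN]
  have hz : (z ^ 2) ⬝ᵥ ((Rᵀ * B * N * R) *ᵥ (h * w)) =
      z ⬝ᵥ ((Rᵀ * B * N * R) *ᵥ (h * w * z)) := by
    rw [sq, boundary_form_mul_left hR hBN, mul_comm z (h * w)]
  rw [add_dotProduct, add_dotProduct, smul_dotProduct, smul_dotProduct, smul_dotProduct, hg, hz]
  simp only [dotProduct_boundary_mulVec hD, smul_eq_mul, Finset.mul_sum,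
    ← Finset.sum_add_distrib]
  exact Finset.sum_congr rfl fun i _ => by
    simp only [Pi.mul_apply, Pi.add_apply, Pi.pow_apply]; ring

end SummationByParts

theorem sw_cancellation_reflecting
    {ι : Type*} [Fintype ι] [DecidableEq ι] [Nonempty ι]
    {κ : Type*} [Fintype κ]
    (M Dx Dy : Matrix ι ι ℝ) (R : Matrix κ ι ℝ) (B Nx Ny : Matrix κ κ ℝ)
    (hMdiag : M.IsDiag) (hMpd : M.PosDef)
    (hSBPx : M * Dx + Dxᵀ * M = Rᵀ * B * Nx * R)
    (hSBPy : M * Dy + Dyᵀ * M = Rᵀ * B * Ny * R)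
    (hRmul : ∀ a c : ι → ℝ, R *ᵥ (a * c) = (R *ᵥ a) * (R *ᵥ c))
    (hBNx : (B * Nx).IsDiag) (hBNy : (B * Ny).IsDiag)
    (g : ℝ) (hg : 0 < g)
    (h u v b : ι → ℝ) :
    (1 : ι → ℝ) ⬝ᵥ (M *ᵥ ((g • h + g • b + u^2/2 + v^2/2) * (u * (Dx *ᵥ h) + h * (Dx *ᵥ u) + v * (Dy *ᵥ h) + h * (Dy *ᵥ v) - M⁻¹ *ᵥ ((Rᵀ * B * Nx * R) *ᵥ (h * u)) - M⁻¹ *ᵥ ((Rᵀ * B * Ny * R) *ᵥ (h * v)))))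
      + u ⬝ᵥ (M *ᵥ (g • (Dx *ᵥ (h * (h + b))) - g • ((h + b) * (Dx *ᵥ h)) + (1/2 : ℝ) • (h * (Dx *ᵥ (u^2))) - (1/2 : ℝ) • (u^2 * (Dx *ᵥ h)) + (1/2 : ℝ) • (u * (Dx *ᵥ (h * u))) - (1/2 : ℝ) • (h * u * (Dx *ᵥ u)) + (1/2 : ℝ) • (Dy *ᵥ (h * u * v)) - (1/2 : ℝ) • (u * v * (Dy *ᵥ h)) + (1/2 : ℝ) • (h * v * (Dy *ᵥ u)) - (1/2 : ℝ) • (h * u * (Dy *ᵥ v))))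
      + v ⬝ᵥ (M *ᵥ (g • (Dy *ᵥ (h * (h + b))) - g • ((h + b) * (Dy *ᵥ h)) + (1/2 : ℝ) • (h * (Dy *ᵥ (v^2))) - (1/2 : ℝ) • (v^2 * (Dy *ᵥ h)) + (1/2 : ℝ) • (v * (Dy *ᵥ (h * v))) - (1/2 : ℝ) • (h * v * (Dy *ᵥ v)) + (1/2 : ℝ) • (Dx *ᵥ (h * u * v)) - (1/2 : ℝ) • (u * v * (Dx *ᵥ h)) + (1/2 : ℝ) • (h * u * (Dx *ᵥ v)) - (1/2 : ℝ) • (h * v * (Dx *ᵥ u))))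
      = 0 := by
  have hM := hMdiag.diagonal_diag
  generalize M.diag = d at hM
  subst hM
  have hinv (q : ι → ℝ) (i : ι) : d i * ((diagonal d)⁻¹ *ᵥ q) i = q i := by
    have hq := congrFun (mulVec_mulVec q (diagonal d) (diagonal d)⁻¹) i
    rwa [mul_nonsing_inv _ ((isUnit_iff_isUnit_det _).mp hMpd.isUnit), one_mulVec,
      mulVec_diagonal] at hq
  have hx := SummationByParts.energy_boundary_term hSBPx hRmul hBNx g h u v b
  have hy := SummationByParts.energy_boundary_term hSBPy hRmul hBNy g h v u b
  have huv : h * v * u = h * u * v := by ring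
  rw [huv] at hy
  have hsum := congrArg Neg.neg (congrArg₂ (· + ·) (sub_eq_zero.mpr hx) (sub_eq_zero.mpr hy))
  simp only [add_zero, neg_zero] at hsum
  refine Eq.trans ?_ hsum
  simp only [dotProduct, mulVec_diagonal, ← Finset.sum_add_distrib, ← Finset.sum_sub_distrib,
    ← Finset.sum_neg_distrib]
  refine Finset.sum_congr rfl fun i _ => ?_
  have hqx := hinv ((Rᵀ * B * Nx * R) *ᵥ (h * u)) i
  have hqy := hinv ((Rᵀ * B * Ny * R) *ᵥ (h * v)) i
  simp only [Pi.add_apply, Pi.sub_apply, Pi.mul_apply, Pi.div_apply, Pi.pow_apply, Pi.smul_apply,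
    Pi.ofNat_apply, smul_eq_mul]
  linear_combination
    -(g * (h i + b i) + u i ^ 2 / 2 + v i ^ 2 / 2) * (hqx + hqy)
end

section
/- Energy conservation for the split form of the one-dimensional shallow water equations with constant bathymetry: let g > 0, L > 0, T > 0, and let h, u : ℝ × ℝ → ℝ be continuously differentiable functions that are L-periodic in the spatial variable x and satisfy, for all t ∈ [0, T] and all x, the split-form equations h_t + h_x u + h u_x = 0 and h u_t + g (h²)_x − g h h_x + (1/2) h (u²)_x − (1/2) h_x u² + (1/2) (h u)_x u − (1/2) h u u_x = 0, where all derivatives of products exist (e.g., h and u are C¹). Then the total energy t ↦ ∫₀ᴸ ((1/2) g h(t,x)² + (1/2) h(t,x) u(t,x)²) dx is constant on [0, T]. -/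
open MeasureTheory

theorem DifferentiableAt.hasDerivAt_slice_fst {f : ℝ × ℝ → ℝ} {t x : ℝ}
    (hf : DifferentiableAt ℝ f (t, x)) :
    HasDerivAt (fun s => f (s, x)) (fderiv ℝ f (t, x) (1, 0)) t :=
  hf.hasFDerivAt.comp_hasDerivAt t ((hasDerivAt_id t).prodMk (hasDerivAt_const t x))

theorem DifferentiableAt.hasDerivAt_slice_snd {f : ℝ × ℝ → ℝ} {t x : ℝ}
    (hf : DifferentiableAt ℝ f (t, x)) :
    HasDerivAt (fun y => f (t, y)) (fderiv ℝ f (t, x) (0, 1)) x :=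
  hf.hasFDerivAt.comp_hasDerivAt x ((hasDerivAt_const x t).prodMk (hasDerivAt_id x))

/-- A density satisfying a `C¹` conservation law on a time interval, with a flux taking equal
values at both endpoints of a space interval, has constant integral. -/
theorem integral_eq_of_conservation_law {a b c d : ℝ} {e f : ℝ × ℝ → ℝ}
    (he : ContDiff ℝ 1 e) (hf : ContDiff ℝ 1 f) (hfbd : ∀ t, f (t, d) = f (t, c))
    (hcons : ∀ t ∈ Set.uIcc a b, ∀ x,
      fderiv ℝ e (t, x) (1, 0) + fderiv ℝ f (t, x) (0, 1) = 0) :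
    ∫ x in c..d, e (a, x) = ∫ x in c..d, e (b, x) := by
  have hi : Continuous fun p => fderiv ℝ e p (1, 0) + fderiv ℝ f p (0, 1) :=
    ((he.continuous_fderiv one_ne_zero).clm_apply continuous_const).add
      ((hf.continuous_fderiv one_ne_zero).clm_apply continuous_const)
  have key := integral2_divergence_prod_of_hasFDerivAt e f (fderiv ℝ e) (fderiv ℝ f) a c b d
    he.continuous.continuousOn hf.continuous.continuousOn
    (fun p _ => (he.differentiable one_ne_zero p).hasFDerivAt)
    (fun p _ => (hf.differentiable one_ne_zero p).hasFDerivAt)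
    (hi.continuousOn.integrableOn_compact (isCompact_uIcc.prod isCompact_uIcc))
  have hzero : (∫ t in a..b, ∫ x in c..d,
      fderiv ℝ e (t, x) (1, 0) + fderiv ℝ f (t, x) (0, 1)) = 0 := by
    rw [intervalIntegral.integral_congr (g := fun _ => (0 : ℝ))
      fun t ht => by simp [hcons t ht], intervalIntegral.integral_zero]
  simp only [hfbd] at key
  linarith

theorem shallow_water_split_form_energy_conservation_1d
    (g L T : ℝ) (hg : 0 < g) (hL : 0 < L) (hT : 0 < T)
    (H U : ℝ × ℝ → ℝ) (hH : ContDiff ℝ 1 H) (hU : ContDiff ℝ 1 U)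
    (hHper : ∀ t x : ℝ, H (t, x + L) = H (t, x))
    (hUper : ∀ t x : ℝ, U (t, x + L) = U (t, x))
    (heq1 : ∀ t ∈ Set.Icc (0:ℝ) T, ∀ x : ℝ,
      deriv (fun s => H (s, x)) t
        + deriv (fun y => H (t, y)) x * U (t, x)
        + H (t, x) * deriv (fun y => U (t, y)) x = 0)
    (heq2 : ∀ t ∈ Set.Icc (0:ℝ) T, ∀ x : ℝ,
      H (t, x) * deriv (fun s => U (s, x)) t
        + g * deriv (fun y => H (t, y)^2) x
        - g * H (t, x) * deriv (fun y => H (t, y)) x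
        + (1/2) * H (t, x) * deriv (fun y => U (t, y)^2) x
        - (1/2) * deriv (fun y => H (t, y)) x * U (t, x)^2
        + (1/2) * deriv (fun y => H (t, y) * U (t, y)) x * U (t, x)
        - (1/2) * H (t, x) * U (t, x) * deriv (fun y => U (t, y)) x = 0) :
    ∀ t₁ ∈ Set.Icc (0:ℝ) T, ∀ t₂ ∈ Set.Icc (0:ℝ) T,
      (∫ x in (0:ℝ)..L, ((1/2) * g * H (t₁, x)^2 + (1/2) * H (t₁, x) * U (t₁, x)^2))
        = ∫ x in (0:ℝ)..L, ((1/2) * g * H (t₂, x)^2 + (1/2) * H (t₂, x) * U (t₂, x)^2) := by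
  intro t₁ ht₁ t₂ ht₂
  have he : ContDiff ℝ 1 fun p => (1/2) * g * H p ^ 2 + (1/2) * H p * U p ^ 2 := by fun_prop
  have hf : ContDiff ℝ 1 fun p => g * H p ^ 2 * U p + (1/2) * H p * U p ^ 3 := by fun_prop
  refine integral_eq_of_conservation_law he hf (fun t => ?_) (fun t ht x => ?_)
  · have hHt := hHper t 0
    have hUt := hUper t 0
    rw [zero_add] at hHt hUt
    simp only [hHt, hUt]
  have ht' : t ∈ Set.Icc 0 T := Set.uIcc_subset_Icc ht₁ ht₂ ht
  have hHd := hH.differentiable one_ne_zero (t, x)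
  have hUd := hU.differentiable one_ne_zero (t, x)
  have hHt := hHd.hasDerivAt_slice_fst
  have hHx := hHd.hasDerivAt_slice_snd
  have hUt := hUd.hasDerivAt_slice_fst
  have hUx := hUd.hasDerivAt_slice_snd
  have mass := heq1 t ht' x
  have momentum := heq2 t ht' x
  rw [hHt.deriv, hHx.deriv, hUx.deriv] at mass
  rw [hUt.deriv, hHx.deriv, hUx.deriv, (hHx.fun_pow 2).deriv, (hUx.fun_pow 2).deriv,
    (hHx.fun_mul hUx).deriv] at momentum
  rw [(he.differentiable one_ne_zero (t, x)).hasDerivAt_slice_fst.unique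
      (((hHt.fun_pow 2).const_mul ((1/2) * g)).fun_add
        ((hHt.const_mul (1/2)).fun_mul (hUt.fun_pow 2))),
    (hf.differentiable one_ne_zero (t, x)).hasDerivAt_slice_snd.unique
      ((((hHx.fun_pow 2).const_mul g).fun_mul hUx).fun_add
        ((hHx.const_mul (1/2)).fun_mul (hUx.fun_pow 3)))]
  push_cast at momentum ⊢
  linear_combination (g * H (t, x) + U (t, x) ^ 2 / 2) * mass + U (t, x) * momentum
end

section
/- Local energy conservation law for the two-dimensional hyperbolic approximation of the Serre–Green–Naghdi equations with variable time-independent bathymetry: let g > 0, λ > 0, let b : ℝ² → ℝ be continuously differentiable, and let h, u, v, η, w : ℝ × ℝ² → ℝ be smooth (C²) with h and η pointwise positive, satisfying for all (t, x, y): h_t + (hu)_x + (hv)_y = 0; (hu)_t + (hu² + g h²/2 + h p)_x + (huv)_y + (g h + (3/2)(h/η) p) b_x = 0; (hv)_t + (huv)_x + (hv² + g h²/2 + h p)_y + (g h + (3/2)(h/η) p) b_y = 0; (hη)_t + (hηu)_x + (hηv)_y + (3/2) h (u b_x + v b_y) = h w; (hw)_t + (hwu)_x + (hwv)_y = λ(1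 − η/h), where p = (λ/3)(η/h)(1 − η/h). Then, with E = h((u² + v²)/2 + e), e = w²/6 + (g/2)(h + 2b) + (λ/6)(η/h − 1)², P = g h²/2 + (λ/3) η (1 − η/h), F₁ = (E + P) u, and F₂ = (E + P) v, the identity E_t + (F₁)_x + (F₂)_y = 0 holds pointwise. -/
noncomputable def pt (f : ℝ → ℝ → ℝ → ℝ) (t x y : ℝ) : ℝ := deriv (fun s => f s x y) t
noncomputable def px (f : ℝ → ℝ → ℝ → ℝ) (t x y : ℝ) : ℝ := deriv (fun s => f t s y) x
noncomputable def py (f : ℝ → ℝ → ℝ → ℝ) (t x y : ℝ) : ℝ := deriv (fun s => f t x s) y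

theorem hasDerivAt_pt {f : ℝ → ℝ → ℝ → ℝ} {n : WithTop ℕ∞} (hn : n ≠ 0)
    (hf : ContDiff ℝ n (fun p : ℝ × ℝ × ℝ => f p.1 p.2.1 p.2.2)) (t x y : ℝ) :
    HasDerivAt (fun s => f s x y) (pt f t x y) t := by
  have hs : ContDiff ℝ n (fun s : ℝ => f s x y) :=
    hf.comp (g := fun p : ℝ × ℝ × ℝ => f p.1 p.2.1 p.2.2)
      (contDiff_id.prodMk (contDiff_const (c := (x, y))))
  exact (hs.differentiable hn t).hasDerivAt

theorem hasDerivAt_px {f : ℝ → ℝ → ℝ → ℝ} {n : WithTop ℕ∞} (hn : n ≠ 0)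
    (hf : ContDiff ℝ n (fun p : ℝ × ℝ × ℝ => f p.1 p.2.1 p.2.2)) (t x y : ℝ) :
    HasDerivAt (fun s => f t s y) (px f t x y) x := by
  have hs : ContDiff ℝ n (fun s : ℝ => f t s y) :=
    hf.comp (g := fun p : ℝ × ℝ × ℝ => f p.1 p.2.1 p.2.2)
      ((contDiff_const (c := t)).prodMk (contDiff_id.prodMk (contDiff_const (c := y))))
  exact (hs.differentiable hn x).hasDerivAt

theorem hasDerivAt_py {f : ℝ → ℝ → ℝ → ℝ} {n : WithTop ℕ∞} (hn : n ≠ 0)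
    (hf : ContDiff ℝ n (fun p : ℝ × ℝ × ℝ => f p.1 p.2.1 p.2.2)) (t x y : ℝ) :
    HasDerivAt (fun s => f t x s) (py f t x y) y := by
  have hs : ContDiff ℝ n (fun s : ℝ => f t x s) :=
    hf.comp (g := fun p : ℝ × ℝ × ℝ => f p.1 p.2.1 p.2.2)
      ((contDiff_const (c := t)).prodMk ((contDiff_const (c := x)).prodMk contDiff_id))
  exact (hs.differentiable hn y).hasDerivAt

section OneVariable

variable {g lam s h' u' v' η' w' b' : ℝ} {h u v η w b : ℝ → ℝ}

theorem HasDerivAt.mul_mul (hh : HasDerivAt h h' s) (hu : HasDerivAt u u' s)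
    (hv : HasDerivAt v v' s) :
    HasDerivAt (fun r => h r * u r * v r)
      ((h' * u s + h s * u') * v s + h s * u s * v') s :=
  (hh.fun_mul hu).fun_mul hv

theorem hasDerivAt_ratio (hh : HasDerivAt h h' s) (hη : HasDerivAt η η' s) (h0 : h s ≠ 0) :
    HasDerivAt (fun r => η r / h r) ((η' - η s / h s * h') / h s) s := by
  refine (hη.fun_div hh h0).congr_deriv ?_
  field_simp

theorem hasDerivAt_momentumFlux (hh : HasDerivAt h h' s) (hu : HasDerivAt u u' s)
    (hη : HasDerivAt η η' s) (h0 : h s ≠ 0) :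
    HasDerivAt (fun r => h r * u r ^ 2 + g * h r ^ 2 / 2 +
        h r * ((lam / 3) * (η r / h r) * (1 - η r / h r)))
      (h' * u s ^ 2 + 2 * h s * u s * u' + g * h s * h' +
        (lam / 3) * (h' * (η s / h s) * (1 - η s / h s) +
          (1 - 2 * (η s / h s)) * (η' - η s / h s * h'))) s := by
  have hq := hasDerivAt_ratio hh hη h0
  refine (((hh.fun_mul (hu.fun_pow 2)).fun_add (((hh.fun_pow 2).const_mul g).div_const 2)).fun_add
    (hh.fun_mul ((hq.const_mul (lam / 3)).fun_mul (hq.const_sub 1)))).congr_deriv ?_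
  norm_num
  field_simp
  ring

theorem hasDerivAt_energy (hh : HasDerivAt h h' s) (hu : HasDerivAt u u' s)
    (hv : HasDerivAt v v' s) (hη : HasDerivAt η η' s) (hw : HasDerivAt w w' s)
    (hb : HasDerivAt b b' s) (h0 : h s ≠ 0) :
    HasDerivAt (fun r => h r * ((u r ^ 2 + v r ^ 2) / 2 + (w r ^ 2 / 6 +
        (g / 2) * (h r + 2 * b r) + (lam / 6) * (η r / h r - 1) ^ 2)))
      (h' * ((u s ^ 2 + v s ^ 2) / 2 + (w s ^ 2 / 6 +
        (g / 2) * (h s + 2 * b s) + (lam / 6) * (η s / h s - 1) ^ 2)) +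
        h s * (u s * u' + v s * v' + w s * w' / 3 + (g / 2) * (h' + 2 * b')) +
        (lam / 3) * (η s / h s - 1) * (η' - η s / h s * h')) s := by
  have hq := hasDerivAt_ratio hh hη h0
  refine (hh.fun_mul ((((hu.fun_pow 2).fun_add (hv.fun_pow 2)).div_const 2).fun_add
    ((((hw.fun_pow 2).div_const 6).fun_add
      ((hh.fun_add (hb.const_mul 2)).const_mul (g / 2))).fun_add
      (((hq.sub_const 1).fun_pow 2).const_mul (lam / 6))))).congr_deriv ?_
  norm_num
  field_simp
  ring

theorem hasDerivAt_pressure (hh : HasDerivAt h h' s) (hη : HasDerivAt η η' s) (h0 : h s ≠ 0) :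
    HasDerivAt (fun r => g * h r ^ 2 / 2 + (lam / 3) * η r * (1 - η r / h r))
      (g * h s * h' + (lam / 3) * (η' * (1 - η s / h s) -
        η s / h s * (η' - η s / h s * h'))) s := by
  have hq := hasDerivAt_ratio hh hη h0
  refine ((((hh.fun_pow 2).const_mul g).div_const 2).fun_add
    ((hη.const_mul (lam / 3)).fun_mul (hq.const_sub 1))).congr_deriv ?_
  norm_num
  field_simp
  ring

end OneVariable

theorem hyperbolic_sgn_local_energy_conservation
    (g lam : ℝ) (hg : 0 < g) (hlam : 0 < lam)
    (b : ℝ → ℝ → ℝ) (hb : ContDiff ℝ 1 (fun p : ℝ × ℝ => b p.1 p.2))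
    (h u v η w : ℝ → ℝ → ℝ → ℝ)
    (hsmh : ContDiff ℝ 2 (fun p : ℝ × ℝ × ℝ => h p.1 p.2.1 p.2.2))
    (hsmu : ContDiff ℝ 2 (fun p : ℝ × ℝ × ℝ => u p.1 p.2.1 p.2.2))
    (hsmv : ContDiff ℝ 2 (fun p : ℝ × ℝ × ℝ => v p.1 p.2.1 p.2.2))
    (hsmη : ContDiff ℝ 2 (fun p : ℝ × ℝ × ℝ => η p.1 p.2.1 p.2.2))
    (hsmw : ContDiff ℝ 2 (fun p : ℝ × ℝ × ℝ => w p.1 p.2.1 p.2.2))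
    (hhpos : ∀ t x y : ℝ, 0 < h t x y) (hηpos : ∀ t x y : ℝ, 0 < η t x y)
    (heq1 : ∀ t x y : ℝ, pt h t x y + px (fun t x y => h t x y * u t x y) t x y + py (fun t x y => h t x y * v t x y) t x y = 0)
    (heq2 : ∀ t x y : ℝ, pt (fun t x y => h t x y * u t x y) t x y + px (fun t x y => h t x y * u t x y^2 + g * h t x y^2/2 + h t x y * ((lam/3) * (η t x y / h t x y) * (1 - η t x y / h t x y))) t x y + py (fun t x y => h t x y * u t x y * v t x y) t x y + (g * h t x y + (3/2) * (h t x y / η t x y) * ((lam/3) * (η t x y / h t x y) * (1 - η t x y / h t x y))) * (deriv (fun s => b s y) x) = 0)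
    (heq3 : ∀ t x y : ℝ, pt (fun t x y => h t x y * v t x y) t x y + px (fun t x y => h t x y * u t x y * v t x y) t x y + py (fun t x y => h t x y * v t x y^2 + g * h t x y^2/2 + h t x y * ((lam/3) * (η t x y / h t x y) * (1 - η t x y / h t x y))) t x y + (g * h t x y + (3/2) * (h t x y / η t x y) * ((lam/3) * (η t x y / h t x y) * (1 - η t x y / h t x y))) * (deriv (fun s => b x s) y) = 0)
    (heq4 : ∀ t x y : ℝ, pt (fun t x y => h t x y * η t x y) t x y + px (fun t x y => h t x y * η t x y * u t x y) t x y + py (fun t x y => h t x y * η t x y * v t x y) t x y + (3/2) * h t x y * (u t x y * (deriv (fun s => b s y) x) + v t x y * (deriv (fun s => b x s) y)) = h t x y * w t x y)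
    (heq5 : ∀ t x y : ℝ, pt (fun t x y => h t x y * w t x y) t x y + px (fun t x y => h t x y * w t x y * u t x y) t x y + py (fun t x y => h t x y * w t x y * v t x y) t x y = lam * (1 - η t x y / h t x y)) :
    ∀ t x y : ℝ, pt (fun t x y => (h t x y * ((u t x y^2 + v t x y^2)/2 + (w t x y^2/6 + (g/2) * (h t x y + 2 * b x y) + (lam/6) * (η t x y / h t x y - 1)^2)))) t x y + px (fun t x y => ((h t x y * ((u t x y^2 + v t x y^2)/2 + (w t x y^2/6 + (g/2) * (h t x y + 2 * b x y) + (lam/6) * (η t x y / h t x y - 1)^2))) + (g * h t x y^2/2 + (lam/3) * η t x y * (1 - η t x y / h t x y))) * u t x y) t x y + py (fun t x y => ((h t x y * ((u t x y^2 + v t x y^2)/2 + (w t x y^2/6 + (g/2) * (h t x y + 2 * b x y) + (lam/6) * (η t x y / h t x y - 1)^2))) + (g * h t x y^2/2 + (lam/3) * η t x y * (1 - η t x y / h t x y))) * v t x y) t x y = 0 := by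
  intro t x y
  have h0 := (hhpos t x y).ne'
  have η0 := (hηpos t x y).ne'
  have n2 : (2 : WithTop ℕ∞) ≠ 0 := two_ne_zero
  have n1 : (1 : WithTop ℕ∞) ≠ 0 := one_ne_zero
  have hbx : HasDerivAt (fun s => b s y) (deriv (fun s => b s y) x) x :=
    hasDerivAt_px (f := fun _ => b) n1 (hb.comp contDiff_snd) t x y
  have hby : HasDerivAt (fun s => b x s) (deriv (fun s => b x s) y) y :=
    hasDerivAt_py (f := fun _ => b) n1 (hb.comp contDiff_snd) t x y
  have hbt : HasDerivAt (fun _ : ℝ => b x y) 0 t := hasDerivAt_const t (b x y)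
  have ht := hasDerivAt_pt n2 hsmh t x y
  have hx := hasDerivAt_px n2 hsmh t x y
  have hy := hasDerivAt_py n2 hsmh t x y
  have ut := hasDerivAt_pt n2 hsmu t x y
  have ux := hasDerivAt_px n2 hsmu t x y
  have uy := hasDerivAt_py n2 hsmu t x y
  have vt := hasDerivAt_pt n2 hsmv t x y
  have vx := hasDerivAt_px n2 hsmv t x y
  have vy := hasDerivAt_py n2 hsmv t x y
  have ηt := hasDerivAt_pt n2 hsmη t x y
  have ηx := hasDerivAt_px n2 hsmη t x y
  have ηy := hasDerivAt_py n2 hsmη t x y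
  have wt := hasDerivAt_pt n2 hsmw t x y
  have wx := hasDerivAt_px n2 hsmw t x y
  have wy := hasDerivAt_py n2 hsmw t x y
  have e1 := heq1 t x y
  have e2 := heq2 t x y
  have e3 := heq3 t x y
  have e4 := heq4 t x y
  have e5 := heq5 t x y
  simp only [px, py] at e1
  rw [(hx.fun_mul ux).deriv, (hy.fun_mul vy).deriv] at e1
  simp only [pt, px, py] at e2
  rw [(ht.fun_mul ut).deriv, (hasDerivAt_momentumFlux (g := g) (lam := lam) hx ux ηx h0).deriv,
    (hy.mul_mul uy vy).deriv] at e2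
  simp only [pt, px, py] at e3
  rw [(ht.fun_mul vt).deriv, (hx.mul_mul ux vx).deriv,
    (hasDerivAt_momentumFlux (g := g) (lam := lam) hy vy ηy h0).deriv] at e3
  simp only [pt, px, py] at e4
  rw [(ht.fun_mul ηt).deriv, (hx.mul_mul ηx ux).deriv,
    (hy.mul_mul ηy vy).deriv] at e4
  simp only [pt, px, py] at e5
  rw [(ht.fun_mul wt).deriv, (hx.mul_mul wx ux).deriv,
    (hy.mul_mul wy vy).deriv] at e5
  simp only [pt, px, py]
  rw [(hasDerivAt_energy (g := g) (lam := lam) ht ut vt ηt wt hbt h0).deriv,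
    (((hasDerivAt_energy (g := g) (lam := lam) hx ux vx ηx wx hbx h0).fun_add
      (hasDerivAt_pressure (g := g) (lam := lam) hx ηx h0)).fun_mul ux).deriv,
    (((hasDerivAt_energy (g := g) (lam := lam) hy uy vy ηy wy hby h0).fun_add
      (hasDerivAt_pressure (g := g) (lam := lam) hy ηy h0)).fun_mul vy).deriv]
  clear hbx hby hbt ht hx hy ut ux uy vt vx vy ηt ηx ηy wt wx wy
  obtain ⟨q, hq⟩ : ∃ q, q = η t x y / h t x y := ⟨_, rfl⟩
  have hηq : η t x y = q * h t x y := by rw [hq, div_mul_cancel₀ _ h0]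
  have hp : 3 / 2 * (h t x y / η t x y) * (lam / 3 * q * (1 - q)) = lam / 2 * (1 - q) := by
    rw [hq]
    field_simp
  rw [← hq] at e2 e3 e5 ⊢
  rw [hp] at e2 e3
  rw [hηq] at e4 ⊢
  refine mul_left_cancel₀ h0 ?_
  linear_combination
    h t x y * (-(u t x y ^ 2 + v t x y ^ 2) / 2 - w t x y ^ 2 / 6 + g * (h t x y + b x y) +
      lam / 6 * (q - 1) ^ 2 - 2 * lam / 3 * (q - 1) * q) * e1 +
    h t x y * u t x y * e2 + h t x y * v t x y * e3 + lam / 3 * (q - 1) * e4 +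
    h t x y * w t x y / 3 * e5
end

section
/- The solitary wave is an exact solution of the one-dimensional Serre–Green–Naghdi equations with flat bathymetry: let g > 0, h∞ > 0, A > 0, set ε = A/h∞, κ = √(3ε/(4 h∞² (1 + ε))), and C = √(g h∞ (1 + ε)), and define h(t, x) = h∞ (1 + ε sech²(κ(x − C t))) and u(t, x) = C (1 − h∞ / h(t, x)). Then h and u satisfy, for all (t, x) ∈ ℝ², the one-dimensional Serre–Green–Naghdi equations h_t + (h u)_x = 0 and (h u)_t + (h u² + g h²/2 + (h²/3) ḧ)_x = 0, where ḣ = h_t + u h_x and ḧ = (ḣ)_t + u (ḣ)_x. -/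
noncomputable def dt2 (f : ℝ → ℝ → ℝ) (t x : ℝ) : ℝ := deriv (fun s => f s x) t
noncomputable def dx2 (f : ℝ → ℝ → ℝ) (t x : ℝ) : ℝ := deriv (fun s => f t s) x

theorem dt2_travelling {F : ℝ → ℝ} {F' C t x : ℝ} (hF : HasDerivAt F F' (x - C * t)) :
    dt2 (fun t x => F (x - C * t)) t x = -C * F' := by
  have h1 : HasDerivAt (fun s : ℝ => x - C * s) (-C) t := by
    simpa using ((hasDerivAt_id t).const_mul C).const_sub x
  have h2 : HasDerivAt (fun s : ℝ => F (x - C * s)) (F' * -C) t := hF.comp t h1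
  rw [dt2, h2.deriv, mul_comm]

theorem dx2_travelling {F : ℝ → ℝ} {F' C t x : ℝ} (hF : HasDerivAt F F' (x - C * t)) :
    dx2 (fun t x => F (x - C * t)) t x = F' := by
  have h1 : HasDerivAt (fun s : ℝ => s - C * t) 1 x := (hasDerivAt_id x).sub_const _
  have h2 : HasDerivAt (fun s : ℝ => F (s - C * t)) (F' * 1) x :=
    HasDerivAt.comp x hF h1
  rw [dx2, h2.deriv, mul_one]

theorem hasDerivAt_sech_sq (κ y : ℝ) :
    HasDerivAt (fun y => (1 / Real.cosh (κ * y)) ^ 2)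
      (-2 * κ * (1 / Real.cosh (κ * y)) ^ 2 * (Real.sinh (κ * y) / Real.cosh (κ * y))) y := by
  have hc := (Real.cosh_pos (κ * y)).ne'
  have hlin : HasDerivAt (fun y : ℝ => κ * y) κ y := by
    simpa using (hasDerivAt_id y).const_mul κ
  refine (((hasDerivAt_const y (1 : ℝ)).div hlin.cosh hc).pow 2).congr_deriv ?_
  simp only [Pi.div_apply]
  push_cast
  field_simp
  ring

theorem hasDerivAt_sinh_div_cosh (κ y : ℝ) :
    HasDerivAt (fun y => Real.sinh (κ * y) / Real.cosh (κ * y))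
      (κ * (1 / Real.cosh (κ * y)) ^ 2) y := by
  have hc := (Real.cosh_pos (κ * y)).ne'
  have hlin : HasDerivAt (fun y : ℝ => κ * y) κ y := by
    simpa using (hasDerivAt_id y).const_mul κ
  refine (hlin.sinh.div hlin.cosh hc).congr_deriv ?_
  field_simp
  linear_combination κ * Real.cosh_sq (κ * y)

theorem sinh_div_cosh_sq (z : ℝ) :
    (Real.sinh z / Real.cosh z) ^ 2 = 1 - (1 / Real.cosh z) ^ 2 := by
  have hc := (Real.cosh_pos z).ne'
  field_simp
  linear_combination -Real.cosh_sq z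

theorem solitary_wave_solves_sgn
    (g hinf A : ℝ) (hg : 0 < g) (hhinf : 0 < hinf) (hA : 0 < A) :
    let ε : ℝ := A / hinf
    let κ : ℝ := Real.sqrt (3 * ε / (4 * hinf^2 * (1 + ε)))
    let C : ℝ := Real.sqrt (g * hinf * (1 + ε))
    let h : ℝ → ℝ → ℝ := fun t x => hinf * (1 + ε * (1 / Real.cosh (κ * (x - C * t)))^2)
    let u : ℝ → ℝ → ℝ := fun t x => C * (1 - hinf / h t x)
    let hdot : ℝ → ℝ → ℝ := fun t x => dt2 h t x + u t x * dx2 h t x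
    let hddot : ℝ → ℝ → ℝ := fun t x => dt2 hdot t x + u t x * dx2 hdot t x
    ∀ t x : ℝ,
      dt2 h t x + dx2 (fun t x => h t x * u t x) t x = 0 ∧
      dt2 (fun t x => h t x * u t x) t x
        + dx2 (fun t x => h t x * u t x^2 + g * h t x^2 / 2 + (h t x^2 / 3) * hddot t x) t x
        = 0 := by
  intro ε κ C h u hdot hddot
  have hε : 0 < ε := div_pos hA hhinf
  have hκ : κ ^ 2 = 3 * ε / (4 * hinf ^ 2 * (1 + ε)) := Real.sq_sqrt (by positivity)
  have hC : C ^ 2 = g * hinf * (1 + ε) := Real.sq_sqrt (by positivity)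
  clear_value ε κ C
  set S : ℝ → ℝ := fun y => (1 / Real.cosh (κ * y)) ^ 2
  set T : ℝ → ℝ := fun y => Real.sinh (κ * y) / Real.cosh (κ * y)
  have hSd : ∀ y, HasDerivAt S (-2 * κ * S y * T y) y := hasDerivAt_sech_sq κ
  have hTd : ∀ y, HasDerivAt T (κ * S y) y := hasDerivAt_sinh_div_cosh κ
  have hTS : ∀ y, T y ^ 2 = 1 - S y := fun y => sinh_div_cosh_sq (κ * y)
  have hS0 : ∀ y, 0 ≤ S y := fun y => sq_nonneg _
  have hh : h = fun t x => hinf * (1 + ε * S (x - C * t)) := rfl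
  clear_value S T h
  have hpos : ∀ y, 0 < 1 + ε * S y := fun y => by
    have := mul_nonneg hε.le (hS0 y)
    linarith
  have hHd : ∀ y, HasDerivAt (fun y => hinf * (1 + ε * S y))
      (hinf * (ε * (-2 * κ * S y * T y))) y :=
    fun y => (((hSd y).const_mul ε).const_add 1).const_mul hinf
  have hht : ∀ t x, dt2 h t x =
      -C * (hinf * (ε * (-2 * κ * S (x - C * t) * T (x - C * t)))) := fun t x => by
    rw [hh]; exact dt2_travelling (hHd _)
  have hhx : ∀ t x, dx2 h t x =
      hinf * (ε * (-2 * κ * S (x - C * t) * T (x - C * t))) := fun t x => by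
    rw [hh]; exact dx2_travelling (hHd _)
  have hhu : (fun t x => h t x * u t x) = fun t x => C * (hinf * (ε * S (x - C * t))) := by
    funext t x
    have := (hpos (x - C * t)).ne'
    simp only [u, hh]
    field_simp
    ring
  have hhud : ∀ y, HasDerivAt (fun y => C * (hinf * (ε * S y)))
      (C * (hinf * (ε * (-2 * κ * S y * T y)))) y :=
    fun y => (((hSd y).const_mul ε).const_mul hinf).const_mul C
  have hhdot : hdot = fun t x => 2 * C * hinf * ε * κ *
      (S (x - C * t) * T (x - C * t) / (1 + ε * S (x - C * t))) := by
    funext t x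
    have := (hpos (x - C * t)).ne'
    simp only [hdot]
    rw [hht, hhx]
    simp only [u, hh]
    field_simp
    ring
  have hGd : ∀ y, HasDerivAt
      (fun y => 2 * C * hinf * ε * κ * (S y * T y / (1 + ε * S y)))
      (2 * C * hinf * ε * κ *
        (((-2 * κ * S y * T y * T y + S y * (κ * S y)) * (1 + ε * S y)
          - S y * T y * (ε * (-2 * κ * S y * T y))) / (1 + ε * S y) ^ 2)) y :=
    fun y => ((((hSd y).mul (hTd y)).div (((hSd y).const_mul ε).const_add 1)
      (hpos y).ne').const_mul _)
  have hhddot : ∀ t x, hddot t x = (u t x - C) * (2 * C * hinf * ε * κ *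
        (((-2 * κ * S (x - C * t) * T (x - C * t) * T (x - C * t)
          + S (x - C * t) * (κ * S (x - C * t))) * (1 + ε * S (x - C * t))
          - S (x - C * t) * T (x - C * t) * (ε * (-2 * κ * S (x - C * t) * T (x - C * t))))
          / (1 + ε * S (x - C * t)) ^ 2)) := fun t x => by
    simp only [hddot]
    rw [hhdot, dt2_travelling (hGd (x - C * t)), dx2_travelling (hGd (x - C * t))]
    ring
  have hflux : (fun t x => h t x * u t x ^ 2 + g * h t x ^ 2 / 2
      + (h t x ^ 2 / 3) * hddot t x) =
      fun t x => C * (C * (hinf * (ε * S (x - C * t)))) + g * hinf ^ 2 / 2 := by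
    funext t x
    have hp := (hpos (x - C * t)).ne'
    have hTS' := hTS (x - C * t)
    rw [hhddot]
    simp only [u, hh]
    generalize S (x - C * t) = s at *
    generalize T (x - C * t) = τ at *
    have hκ' : κ ^ 2 * (4 * hinf ^ 2 * (1 + ε)) = 3 * ε := by
      rw [hκ]; field_simp
    have key : hinf * C ^ 2 * ε ^ 2 * s ^ 2 + g * hinf ^ 2 * (1 + ε * s) ^ 3 / 2
        - 2 / 3 * hinf ^ 3 * C ^ 2 * ε * κ ^ 2
          * ((-2 * s * τ ^ 2 + s ^ 2) * (1 + ε * s) + 2 * ε * s ^ 2 * τ ^ 2)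
        - C ^ 2 * hinf * ε * s * (1 + ε * s) - g * hinf ^ 2 * (1 + ε * s) / 2 = 0 := by
      linear_combination
        (hinf * ε ^ 2 * s ^ 2 - hinf * ε * s * (1 + ε * s) - 2 / 3 * hinf ^ 3 * ε * κ ^ 2
          * ((-2 * s * τ ^ 2 + s ^ 2) * (1 + ε * s) + 2 * ε * s ^ 2 * τ ^ 2)) * hC
        - g * hinf ^ 2 * ε / 6
          * ((-2 * s * τ ^ 2 + s ^ 2) * (1 + ε * s) + 2 * ε * s ^ 2 * τ ^ 2) * hκ'
        + g * hinf ^ 2 * ε ^ 2 * s * hTS'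
    rw [← sub_eq_zero]
    trans (0 : ℝ) / (1 + ε * s)
    · rw [← key]
      field_simp
      ring
    · exact zero_div _
  intro t x
  refine ⟨?_, ?_⟩
  · rw [hhu, hht, dx2_travelling (hhud _)]
    ring
  · rw [hflux, hhu, dt2_travelling (hhud _),
      dx2_travelling (((hhud _).const_mul C).add_const _)]
    ring
end
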